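/- arXiv:2506.22959 — 7 statements merged into one kernel-verified Lean document; each statement's English description precedes it below -/
import Mathlib

section
/- Let N ≥ 2, r_1,…,r_N ∈ (0,1), M ≥ 2 an integer, and p = (p_1,…,p_N) ∈ (0,1)^N a probability vector. Let s_0 solve Σ_{i=1}^N r_i^{s_0} = 1 and s̃ solve Σ_{i=1}^N p_i r_i^{s̃} = 1/M. If Σ_{i=1}^N r_i^{s_0} log(M p_i) < 0 < Σ_{i=1}^N p_i r_i^{s̃} log(M p_i), then there is a unique pair (ŝ, t̂) of real numbers, with ŝ > 0, satisfying the equations Σ_{i=1}^N r_i^{ŝ}(M p_i)^{t̂} = 1 and Σ_{i=1}^N r_i^{ŝ}(M p_i)^{t̂} log(M p_i) = 0. -/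
open Set

/-- The exponential sum `∑ exp (s aᵢ + t bᵢ)`. -/
noncomputable def expSum {ι : Type*} [Fintype ι] (a b : ι → ℝ) (s t : ℝ) : ℝ :=
  ∑ i, Real.exp (s * a i + t * b i)

/-- The exponential sum `∑ exp (s aᵢ + t bᵢ) wᵢ` with weights `w`. -/
noncomputable def weightedExpSum {ι : Type*} [Fintype ι] (a b w : ι → ℝ) (s t : ℝ) : ℝ :=
  ∑ i, Real.exp (s * a i + t * b i) * w i

section ExpSum

variable {ι : Type*} [Fintype ι] (a b : ι → ℝ)

lemma continuous_expSum : Continuous fun x : ℝ × ℝ => expSum a b x.1 x.2 := by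
  unfold expSum
  fun_prop

lemma continuous_weightedExpSum (w : ι → ℝ) :
    Continuous fun x : ℝ × ℝ => weightedExpSum a b w x.1 x.2 := by
  unfold weightedExpSum
  fun_prop

lemma exp_tangent_le (x y : ℝ) : Real.exp x + Real.exp x * (y - x) ≤ Real.exp y := by
  have h := mul_le_mul_of_nonneg_left (Real.add_one_le_exp (y - x)) (Real.exp_pos x).le
  rw [← Real.exp_add, add_sub_cancel] at h
  linarith

lemma exp_tangent_lt {x y : ℝ} (hxy : x ≠ y) :
    Real.exp x + Real.exp x * (y - x) < Real.exp y := by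
  have h := mul_lt_mul_of_pos_left (Real.add_one_lt_exp (sub_ne_zero.2 hxy.symm)) (Real.exp_pos x)
  rw [← Real.exp_add, add_sub_cancel] at h
  linarith

lemma expSum_tangent_eq (s t s' t' : ℝ) :
    expSum a b s t + (s' - s) * weightedExpSum a b a s t + (t' - t) * weightedExpSum a b b s t =
      ∑ i, (Real.exp (s * a i + t * b i) + Real.exp (s * a i + t * b i) *
        ((s' * a i + t' * b i) - (s * a i + t * b i))) := by
  unfold expSum weightedExpSum
  rw [Finset.mul_sum, Finset.mul_sum, ← Finset.sum_add_distrib, ← Finset.sum_add_distrib]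
  exact Finset.sum_congr rfl fun i _ => by ring

lemma expSum_tangent_le (s t s' t' : ℝ) :
    expSum a b s t + (s' - s) * weightedExpSum a b a s t + (t' - t) * weightedExpSum a b b s t ≤
      expSum a b s' t' := by
  rw [expSum_tangent_eq]
  exact Finset.sum_le_sum fun i _ => exp_tangent_le _ _

variable {a b}

lemma expSum_strictAnti [Nonempty ι] (ha : ∀ i, a i < 0) (t : ℝ) :
    StrictAnti fun s => expSum a b s t := by
  intro s s' h
  refine Finset.sum_lt_sum_of_nonempty Finset.univ_nonempty fun i _ => Real.exp_lt_exp.2 ?_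
  have := mul_lt_mul_of_neg_right h (ha i)
  linarith

lemma weightedExpSum_neg [Nonempty ι] {w : ι → ℝ} (hw : ∀ i, w i < 0) (s t : ℝ) :
    weightedExpSum a b w s t < 0 :=
  Finset.sum_neg (fun i _ => mul_neg_of_pos_of_neg (Real.exp_pos _) (hw i)) Finset.univ_nonempty

lemma expSum_critical_unique (ha : ∀ i, a i < 0) (hb : ∃ i, b i ≠ 0) {s t s' t' : ℝ}
    (h : expSum a b s t = 1) (hd : weightedExpSum a b b s t = 0)
    (h' : expSum a b s' t' = 1) (hd' : weightedExpSum a b b s' t' = 0) :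
    s = s' ∧ t = t' := by
  obtain ⟨j, hj⟩ := hb
  have : Nonempty ι := ⟨j⟩
  have h₁ := expSum_tangent_le a b s t s' t'
  have h₂ := expSum_tangent_le a b s' t' s t
  have n₁ := weightedExpSum_neg (a := a) (b := b) ha s t
  have n₂ := weightedExpSum_neg (a := a) (b := b) ha s' t'
  rw [h, hd, h'] at h₁
  rw [h, hd', h'] at h₂
  have hs : s = s' := le_antisymm (by nlinarith) (by nlinarith)
  subst hs
  refine ⟨rfl, by_contra fun ht => ?_⟩
  have key : expSum a b s t + (s - s) * weightedExpSum a b a s t +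
      (t' - t) * weightedExpSum a b b s t < expSum a b s t' := by
    rw [expSum_tangent_eq]
    refine Finset.sum_lt_sum (fun i _ => exp_tangent_le _ _)
      ⟨j, Finset.mem_univ j, exp_tangent_lt fun e => ht ?_⟩
    exact mul_right_cancel₀ hj (add_left_cancel e)
  rw [h, hd, h'] at key
  linarith

lemma exists_expSum_lt_of_weightedExpSum_neg {s t u : ℝ} (htu : t < u)
    (hd : weightedExpSum a b b s t < 0) :
    ∃ t' ∈ Ioo t u, expSum a b s t' < expSum a b s t := by
  have hc : Continuous fun x => weightedExpSum a b b s x :=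
    (continuous_weightedExpSum a b b).comp (Continuous.prodMk_right s)
  have h₁ : ∀ᶠ x in nhdsWithin t (Ioi t), weightedExpSum a b b s x < 0 :=
    nhdsWithin_le_nhds (hc.continuousAt.eventually_lt_const hd)
  obtain ⟨x, hx, hxI⟩ := (h₁.and (Ioo_mem_nhdsGT htu)).exists
  refine ⟨x, hxI, ?_⟩
  have h₂ := expSum_tangent_le a b s x s t
  nlinarith [hxI.1]

lemma exists_expSum_lt_of_weightedExpSum_pos {s t u : ℝ} (hut : u < t)
    (hd : 0 < weightedExpSum a b b s t) :
    ∃ t' ∈ Ioo u t, expSum a b s t' < expSum a b s t := by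
  have hc : Continuous fun x => weightedExpSum a b b s x :=
    (continuous_weightedExpSum a b b).comp (Continuous.prodMk_right s)
  have h₁ : ∀ᶠ x in nhdsWithin t (Iio t), 0 < weightedExpSum a b b s x :=
    nhdsWithin_le_nhds (hc.continuousAt.eventually_const_lt hd)
  obtain ⟨x, hx, hxI⟩ := (h₁.and (Ioo_mem_nhdsLT hut)).exists
  refine ⟨x, hxI, ?_⟩
  have h₂ := expSum_tangent_le a b s x s t
  nlinarith [hxI.2]

lemma exists_expSum_critical [Nonempty ι] (ha : ∀ i, a i < 0)
    (hpos : ∀ t ∈ Icc (0 : ℝ) 1, 1 < expSum a b 0 t) {s₀ s₁ : ℝ}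
    (h₀ : expSum a b s₀ 0 = 1) (h₁ : expSum a b s₁ 1 = 1)
    (hd₀ : weightedExpSum a b b s₀ 0 < 0) (hd₁ : 0 < weightedExpSum a b b s₁ 1) :
    ∃ s t, 0 < s ∧ expSum a b s t = 1 ∧ weightedExpSum a b b s t = 0 := by
  have pos_of_le : ∀ s, ∀ t ∈ Icc (0 : ℝ) 1, expSum a b s t ≤ 1 → 0 < s := fun s t ht h =>
    (expSum_strictAnti (b := b) ha t).lt_iff_gt.1 (h.trans_lt (hpos t ht))
  have hs₀ : 0 < s₀ := pos_of_le s₀ 0 (by simp) h₀.le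
  let K : Set (ℝ × ℝ) := (Icc 0 s₀ ×ˢ Icc 0 1) ∩ {x | expSum a b x.1 x.2 ≤ 1}
  have hK : IsCompact K := (isCompact_Icc.prod isCompact_Icc).inter_right
    (isClosed_le (continuous_expSum a b) continuous_const)
  have hne : K.Nonempty := ⟨(s₀, 0), ⟨⟨⟨hs₀.le, le_rfl⟩, ⟨le_rfl, zero_le_one⟩⟩, h₀.le⟩⟩
  obtain ⟨⟨s, t⟩, ⟨⟨hs, ht⟩, hle⟩, hmin⟩ := hK.exists_isMinOn hne continuous_fst.continuousOn
  simp only [mem_ofPred_eq] at hs ht hle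
  have hspos := pos_of_le s t ht hle
  have one_le : ∀ u ∈ Icc (0 : ℝ) 1, 1 ≤ expSum a b s u := by
    intro u hu
    by_contra! hlt
    have hc : Continuous fun x => expSum a b x u :=
      (continuous_expSum a b).comp (Continuous.prodMk_left u)
    have hev : ∀ᶠ x in nhdsWithin s (Iio s), expSum a b x u < 1 :=
      nhdsWithin_le_nhds (hc.continuousAt.eventually_lt_const hlt)
    obtain ⟨x, hx, hxI⟩ := (hev.and (Ioo_mem_nhdsLT hspos)).exists
    have hxK : (x, u) ∈ K := ⟨⟨⟨hxI.1.le, hxI.2.le.trans hs.2⟩, hu⟩, hx.le⟩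
    exact absurd (hmin hxK) (not_le.2 hxI.2)
  have heq : expSum a b s t = 1 := le_antisymm hle (one_le t ht)
  refine ⟨s, t, hspos, heq, ?_⟩
  rcases lt_trichotomy (weightedExpSum a b b s t) 0 with hd | hd | hd
  · have ht1 : t < 1 := by
      refine lt_of_le_of_ne ht.2 fun e => ?_
      subst e
      have : s = s₁ := (expSum_strictAnti (b := b) ha 1).injective (heq.trans h₁.symm)
      subst this
      exact lt_asymm hd hd₁
    obtain ⟨u, hu, hlt⟩ := exists_expSum_lt_of_weightedExpSum_neg ht1 hd
    have := one_le u ⟨ht.1.trans hu.1.le, hu.2.le⟩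
    linarith
  · exact hd
  · have ht0 : 0 < t := by
      refine lt_of_le_of_ne ht.1 fun e => ?_
      subst e
      have : s = s₀ := (expSum_strictAnti (b := b) ha 0).injective (heq.trans h₀.symm)
      subst this
      exact lt_asymm hd hd₀
    obtain ⟨u, hu, hlt⟩ := exists_expSum_lt_of_weightedExpSum_pos ht0 hd
    have := one_le u ⟨hu.1.le, hu.2.le.trans ht.2⟩
    linarith

end ExpSum

lemma one_lt_sum_rpow_of_one_lt_sum {ι : Type*} [Fintype ι] [Nontrivial ι] {q : ι → ℝ}
    (hq : ∀ i, 0 < q i) (hsum : 1 < ∑ i, q i) {t : ℝ} (ht : t ∈ Icc (0 : ℝ) 1) :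
    1 < ∑ i, q i ^ t := by
  by_cases h : ∃ i, 1 ≤ q i
  · obtain ⟨i, hi⟩ := h
    obtain ⟨j, hj⟩ := exists_ne i
    exact (Real.one_le_rpow hi ht.1).trans_lt
      (Finset.single_lt_sum hj (Finset.mem_univ i) (Finset.mem_univ j)
        (Real.rpow_pos_of_pos (hq j) t) fun k _ _ => (Real.rpow_pos_of_pos (hq k) t).le)
  · push Not at h
    refine hsum.trans_le (Finset.sum_le_sum fun i _ => ?_)
    simpa using Real.rpow_le_rpow_of_exponent_ge (hq i) (h i).le ht.2

theorem exists_unique_shat_that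
    {N : ℕ} (hN : 2 ≤ N) (r : Fin N → ℝ) (hr : ∀ i, r i ∈ Ioo (0 : ℝ) 1)
    (M : ℕ) (hM : 2 ≤ M)
    (p : Fin N → ℝ) (hp : ∀ i, p i ∈ Ioo (0 : ℝ) 1) (hpsum : ∑ i, p i = 1)
    (s₀ : ℝ) (hs₀ : ∑ i, r i ^ s₀ = 1)
    (st : ℝ) (hst : ∑ i, p i * r i ^ st = 1 / M)
    (hcond₁ : ∑ i, r i ^ s₀ * Real.log (M * p i) < 0)
    (hcond₂ : 0 < ∑ i, p i * r i ^ st * Real.log (M * p i)) :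
    ∃! sht : ℝ × ℝ, 0 < sht.1 ∧
      ∑ i, r i ^ sht.1 * (M * p i) ^ sht.2 = 1 ∧
      ∑ i, r i ^ sht.1 * (M * p i) ^ sht.2 * Real.log (M * p i) = 0 := by
  have : Nontrivial (Fin N) := Fin.nontrivial_iff_two_le.2 hN
  have hM0 : (0 : ℝ) < M := by positivity
  have hM1 : (1 : ℝ) < M := by exact_mod_cast hM
  have hq : ∀ i, 0 < M * p i := fun i => mul_pos hM0 (hp i).1
  let a : Fin N → ℝ := fun i => Real.log (r i)
  let b : Fin N → ℝ := fun i => Real.log (M * p i)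
  have ha : ∀ i, a i < 0 := fun i => Real.log_neg (hr i).1 (hr i).2
  have term : ∀ s t i, r i ^ s * (M * p i) ^ t = Real.exp (s * a i + t * b i) := fun s t i => by
    rw [Real.rpow_def_of_pos (hr i).1, Real.rpow_def_of_pos (hq i), ← Real.exp_add,
      mul_comm s, mul_comm t]
  have hF : ∀ s t, ∑ i, r i ^ s * (M * p i) ^ t = expSum a b s t := fun s t =>
    Finset.sum_congr rfl fun i _ => term s t i
  have hD : ∀ s t, ∑ i, r i ^ s * (M * p i) ^ t * Real.log (M * p i) =
      weightedExpSum a b b s t := fun s t =>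
    Finset.sum_congr rfl fun i _ => by rw [term s t i]
  simp only [hF, hD]
  have hb : ∃ i, b i ≠ 0 := by
    by_contra! h
    exact hcond₁.ne (Finset.sum_eq_zero fun i _ => mul_eq_zero_of_right _ (h i))
  have hpos : ∀ t ∈ Icc (0 : ℝ) 1, 1 < expSum a b 0 t := fun t ht => by
    rw [← hF]
    simpa using one_lt_sum_rpow_of_one_lt_sum hq (by rwa [← Finset.mul_sum, hpsum, mul_one]) ht
  have h₀ : expSum a b s₀ 0 = 1 := by
    rw [← hF]
    simpa using hs₀
  have hd₀ : weightedExpSum a b b s₀ 0 < 0 := by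
    rw [← hD]
    simpa using hcond₁
  have h₁ : expSum a b st 1 = 1 := by
    rw [← hF]
    calc ∑ i, r i ^ st * (M * p i) ^ (1 : ℝ) = M * ∑ i, p i * r i ^ st := by
          rw [Finset.mul_sum]
          exact Finset.sum_congr rfl fun i _ => by rw [Real.rpow_one]; ring
      _ = 1 := by rw [hst, mul_one_div_cancel hM0.ne']
  have hd₁ : 0 < weightedExpSum a b b st 1 := by
    rw [← hD]
    calc 0 < M * ∑ i, p i * r i ^ st * Real.log (M * p i) := mul_pos hM0 hcond₂
      _ = _ := by
          rw [Finset.mul_sum]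
          exact Finset.sum_congr rfl fun i _ => by rw [Real.rpow_one]; ring
  obtain ⟨s, t, hs, h, hd⟩ := exists_expSum_critical ha hpos h₀ h₁ hd₀ hd₁
  refine ⟨(s, t), ⟨hs, h, hd⟩, ?_⟩
  rintro ⟨s', t'⟩ ⟨-, h', hd'⟩
  obtain ⟨rfl, rfl⟩ := expSum_critical_unique ha hb h hd h' hd'
  rfl
end

section
/- Let r_1 < r_2 be in (0,1) and 1/2 ≤ p < 1, and let s̃ = s̃(p) be the unique real with p r_1^{s̃} + (1−p) r_2^{s̃} = 1/2. Then r_1^{s̃} log r_1 < r_2^{s̃} log r_2. -/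
open Set

/-- `u ↦ u log u` takes a smaller value at `x < 1/2` than at the reflected point `1 - x`. -/
lemma mul_log_lt_one_sub_mul_log_one_sub {x : ℝ} (hx : 0 < x) (hx' : x < 1 / 2) :
    x * Real.log x < (1 - x) * Real.log (1 - x) := by
  have h := strictConcaveOn_log_Ioi.secant_strict_mono (a := 1) (x := x) (y := 1 - x)
    (mem_Ioi.2 one_pos) (mem_Ioi.2 hx) (mem_Ioi.2 (by linarith)) (by linarith) (by linarith)
    (by linarith)
  have e₁ : (1 : ℝ) - x - 1 = -x := by ring
  have e₂ : x - 1 = -(1 - x) := by ring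
  rw [Real.log_one, sub_zero, sub_zero, e₁, e₂, div_neg, div_neg, neg_lt_neg_iff,
    div_lt_div_iff₀ (by linarith) hx] at h
  linarith

/-- `u ↦ u log u` is monotone on `[1/2, ∞)`. -/
lemma mul_log_le_mul_log_of_half_le {z y : ℝ} (hz : 1 / 2 ≤ z) (hzy : z ≤ y) :
    z * Real.log z ≤ y * Real.log y := by
  have hz0 : 0 < z := by linarith
  have hy0 : 0 < y := by linarith
  have hlog : -1 ≤ Real.log z := by
    have h₁ := Real.one_sub_inv_le_log_of_pos hz0
    have h₂ : z⁻¹ ≤ 2 := by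
      rw [inv_le_comm₀ hz0 two_pos]
      linarith
    linarith
  have h := Real.log_le_sub_one_of_pos (div_pos hz0 hy0)
  rw [Real.log_div hz0.ne' hy0.ne'] at h
  have h' := mul_le_mul_of_nonneg_left h hy0.le
  rw [mul_sub y (z / y), mul_div_cancel₀ z hy0.ne'] at h'
  nlinarith [mul_nonneg (sub_nonneg.2 hzy) (by linarith : 0 ≤ 1 + Real.log z)]

theorem rpow_mul_log_lt
    (r₁ r₂ : ℝ) (hr₁ : r₁ ∈ Ioo (0 : ℝ) 1) (hr₂ : r₂ ∈ Ioo (0 : ℝ) 1) (hlt : r₁ < r₂)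
    (p : ℝ) (hp : p ∈ Ico (1 / 2 : ℝ) 1)
    (st : ℝ) (hst : p * r₁ ^ st + (1 - p) * r₂ ^ st = 1 / 2) :
    r₁ ^ st * Real.log r₁ < r₂ ^ st * Real.log r₂ := by
  obtain ⟨h₁, h₁'⟩ := hr₁
  obtain ⟨h₂, h₂'⟩ := hr₂
  obtain ⟨hp₁, hp₂⟩ := hp
  have hs : 0 < st := by
    by_contra! hs
    have hx := Real.one_le_rpow_of_pos_of_le_one_of_nonpos h₁ h₁'.le hs
    have hy := Real.one_le_rpow_of_pos_of_le_one_of_nonpos h₂ h₂'.le hs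
    nlinarith
  have hxy : r₁ ^ st < r₂ ^ st := Real.rpow_lt_rpow h₁.le hlt hs
  have hx0 : 0 < r₁ ^ st := Real.rpow_pos_of_pos h₁ st
  have hl₁ := Real.log_rpow h₁ st
  have hl₂ := Real.log_rpow h₂ st
  generalize r₁ ^ st = x at *
  generalize r₂ ^ st = y at *
  have hx : x < 1 / 2 := by nlinarith
  have hsum : 1 - x ≤ y := by nlinarith
  have key : x * Real.log x < y * Real.log y :=
    (mul_log_lt_one_sub_mul_log_one_sub hx0 hx).trans_le
      (mul_log_le_mul_log_of_half_le (by linarith) hsum)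
  rw [hl₁, hl₂] at key
  refine lt_of_mul_lt_mul_left ?_ hs.le
  linarith
end

section
/- Let r_1 < r_2 be in (0,1). Then the function p ↦ s̃(p), where s̃(p) is the unique real with p r_1^{s̃(p)} + (1−p) r_2^{s̃(p)} = 1/2, is strictly decreasing and strictly convex on the interval 1/2 ≤ p ≤ 1. -/
open Set

/-- The sign of the second derivative of `(1 - exp (b s) / 2) / (1 - exp (-c s))`. -/
lemma second_deriv_numerator_pos {b c s : ℝ} (hb : 0 < b) (hs : 0 < s) (hc : 0 < c)
    (hE : Real.exp (b * s) ≤ 1 + Real.exp (-(c * s))) :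
    0 < -(b ^ 2 * Real.exp (b * s) / 2) * (1 - Real.exp (-(c * s))) ^ 2
      + b * c * Real.exp (b * s) * Real.exp (-(c * s)) * (1 - Real.exp (-(c * s)))
      + (1 - Real.exp (b * s) / 2) * c ^ 2 * Real.exp (-(c * s))
        * (1 + Real.exp (-(c * s))) := by
  have hcs : 0 < c * s := mul_pos hc hs
  obtain ⟨w, hw⟩ : ∃ w, w = Real.exp (-(c * s) / 2) := ⟨_, rfl⟩
  have hu : Real.exp (-(c * s)) = w ^ 2 := by
    rw [hw, ← Real.exp_nat_mul]; congr 1; push_cast; ring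
  have hw0 : 0 < w := hw ▸ Real.exp_pos _
  have hw1 : w < 1 := by rw [hw, Real.exp_lt_one_iff]; linarith
  have hwc : 1 - c * s / 2 ≤ w := by
    have := Real.add_one_le_exp (-(c * s) / 2)
    rw [← hw] at this; linarith
  have hbE := Real.add_one_le_exp (b * s)
  rw [hu] at hE ⊢
  generalize Real.exp (b * s) = E at *
  have hE0 : 0 < E := by nlinarith [mul_pos hb hs]
  have key : b < w * (b + c) := by
    have h1 : b * s * (1 - w) ≤ w ^ 2 * (1 - w) :=
      mul_le_mul_of_nonneg_right (by linarith) (by linarith)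
    have h2 : w * (2 * (1 - w)) ≤ w * (c * s) :=
      mul_le_mul_of_nonneg_left (by linarith) hw0.le
    have h3 : 0 < w * (1 - w) * (2 - w) :=
      mul_pos (mul_pos hw0 (by linarith)) (by linarith)
    have h4 : b * s < w * (b + c) * s := by nlinarith
    exact lt_of_mul_lt_mul_right h4 hs.le
  have key2 : b ^ 2 < w ^ 2 * (b + c) ^ 2 := by
    rw [← mul_pow]; exact pow_lt_pow_left₀ key hb.le two_ne_zero
  have hv : 0 < 1 - w ^ 2 := by nlinarith
  have h5 : 0 ≤ c ^ 2 * w ^ 2 * (1 + w ^ 2 - E) := by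
    have : 0 ≤ 1 + w ^ 2 - E := by linarith
    positivity
  have h6 : 0 < E * (1 - w ^ 2) * (w ^ 2 * (b + c) ^ 2 - b ^ 2) :=
    mul_pos (mul_pos hE0 hv) (by linarith)
  nlinarith

lemma strictConvexOn_exp_quotient {b c t : ℝ} (hb : 0 < b) (hc : 0 < c)
    (ht : Real.exp (b * t) ≤ 1 + Real.exp (-(c * t))) :
    StrictConvexOn ℝ (Ioc 0 t)
      (fun s => (1 - Real.exp (b * s) / 2) / (1 - Real.exp (-(c * s)))) := by
  have hne : ∀ s : ℝ, 0 < s → 1 - Real.exp (-(c * s)) ≠ 0 := fun s hs => by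
    have : Real.exp (-(c * s)) < 1 := by
      rw [Real.exp_lt_one_iff]; linarith [mul_pos hc hs]
    linarith
  have hE : ∀ s : ℝ, HasDerivAt (fun s => Real.exp (b * s)) (b * Real.exp (b * s)) s := fun s => by
    simpa [mul_comm] using ((hasDerivAt_id s).const_mul b).exp
  have hu : ∀ s : ℝ, HasDerivAt (fun s => Real.exp (-(c * s))) (-(c * Real.exp (-(c * s)))) s :=
    fun s => by simpa [mul_comm] using ((hasDerivAt_id s).const_mul c).neg.exp
  have hd1 : ∀ s : ℝ, 0 < s → HasDerivAt
      (fun s => (1 - Real.exp (b * s) / 2) / (1 - Real.exp (-(c * s))))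
      ((-(b * Real.exp (b * s) / 2) * (1 - Real.exp (-(c * s)))
        - (1 - Real.exp (b * s) / 2) * (c * Real.exp (-(c * s))))
        / (1 - Real.exp (-(c * s))) ^ 2) s := fun s hs => by
    refine ((((hE s).div_const 2).const_sub 1).div ((hu s).const_sub 1) (hne s hs)).congr_deriv ?_
    ring
  apply strictConvexOn_of_deriv2_pos (convex_Ioc 0 t)
  · exact fun s hs => (hd1 s hs.1).continuousAt.continuousWithinAt
  · intro s hs
    rw [interior_Ioc] at hs
    have hs0 := hs.1
    have hev : deriv (fun s => (1 - Real.exp (b * s) / 2) / (1 - Real.exp (-(c * s))))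
        =ᶠ[nhds s] fun s => (-(b * Real.exp (b * s) / 2) * (1 - Real.exp (-(c * s)))
        - (1 - Real.exp (b * s) / 2) * (c * Real.exp (-(c * s))))
        / (1 - Real.exp (-(c * s))) ^ 2 := by
      filter_upwards [Ioi_mem_nhds hs0] with x hx using (hd1 x hx).deriv
    have hd2 := ((((((hE s).const_mul b).div_const 2).neg.mul ((hu s).const_sub 1)).sub
      ((((hE s).div_const 2).const_sub 1).mul ((hu s).const_mul c))).div
      (((hu s).const_sub 1).pow 2) (pow_ne_zero 2 (hne s hs0)))
    have hsE : Real.exp (b * s) ≤ 1 + Real.exp (-(c * s)) := by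
      have h1 : Real.exp (b * s) ≤ Real.exp (b * t) :=
        Real.exp_le_exp.2 (mul_le_mul_of_nonneg_left hs.2.le hb.le)
      have h2 : Real.exp (-(c * t)) ≤ Real.exp (-(c * s)) :=
        Real.exp_le_exp.2 (neg_le_neg (mul_le_mul_of_nonneg_left hs.2.le hc.le))
      linarith
    have hpos := second_deriv_numerator_pos hb hs0 hc hsE
    have hD : 0 < 1 - Real.exp (-(c * s)) := by
      have : Real.exp (-(c * s)) < 1 := by
        rw [Real.exp_lt_one_iff]; linarith [mul_pos hc hs0]
      linarith
    have hval : deriv^[2] (fun s => (1 - Real.exp (b * s) / 2) / (1 - Real.exp (-(c * s)))) s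
        = (-(b ^ 2 * Real.exp (b * s) / 2) * (1 - Real.exp (-(c * s))) ^ 2
          + b * c * Real.exp (b * s) * Real.exp (-(c * s)) * (1 - Real.exp (-(c * s)))
          + (1 - Real.exp (b * s) / 2) * c ^ 2 * Real.exp (-(c * s))
            * (1 + Real.exp (-(c * s)))) / (1 - Real.exp (-(c * s))) ^ 3 := by
      rw [Function.iterate_succ, Function.iterate_one, Function.comp_apply, hev.deriv_eq]
      refine hd2.deriv.trans ?_
      have := hD.ne'
      simp only [Pi.pow_apply, Pi.mul_apply, Pi.neg_apply, Pi.sub_apply]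
      generalize Real.exp (b * s) = E at *
      generalize Real.exp (-(c * s)) = u at *
      field_simp
      ring
    rw [hval]
    exact div_pos hpos (pow_pos hD 3)

theorem stilde_strictAnti_strictConvex
    (r₁ r₂ : ℝ) (hr₁ : r₁ ∈ Ioo (0 : ℝ) 1) (hr₂ : r₂ ∈ Ioo (0 : ℝ) 1) (hlt : r₁ < r₂)
    (st : ℝ → ℝ)
    (hst : ∀ p ∈ Icc (1 / 2 : ℝ) 1, p * r₁ ^ st p + (1 - p) * r₂ ^ st p = 1 / 2) :
    StrictAntiOn st (Icc (1 / 2 : ℝ) 1) ∧ StrictConvexOn ℝ (Icc (1 / 2 : ℝ) 1) st := by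
  have hanti : ∀ p ∈ Icc (1 / 2 : ℝ) 1,
      StrictAnti fun s : ℝ => p * r₁ ^ s + (1 - p) * r₂ ^ s := fun p hp x y hxy => by
    have h1 := Real.rpow_lt_rpow_of_exponent_gt hr₁.1 hr₁.2 hxy
    have h2 := Real.rpow_lt_rpow_of_exponent_gt hr₂.1 hr₂.2 hxy
    have h3 : p * r₁ ^ y < p * r₁ ^ x := mul_lt_mul_of_pos_left h1 (by linarith [hp.1])
    have h4 : (1 - p) * r₂ ^ y ≤ (1 - p) * r₂ ^ x :=
      mul_le_mul_of_nonneg_left h2.le (by linarith [hp.2])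
    exact add_lt_add_of_lt_of_le h3 h4
  have hpos : ∀ p ∈ Icc (1 / 2 : ℝ) 1, 0 < st p := fun p hp => by
    refine (hanti p hp).lt_iff_gt.1 ?_
    simp only [hst p hp, Real.rpow_zero]
    linarith
  have hlt' : ∀ s : ℝ, 0 < s → r₁ ^ s < r₂ ^ s := fun s hs =>
    Real.rpow_lt_rpow hr₁.1.le hlt hs
  have hA : StrictAntiOn st (Icc (1 / 2 : ℝ) 1) := fun p hp q hq hpq => by
    refine (hanti q hq).lt_iff_gt.1 ?_
    simp only [hst q hq]
    nlinarith [hst p hp, hlt' _ (hpos p hp)]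
  refine ⟨hA, convex_Icc _ _, fun p hp q hq hpq α β hα hβ hαβ => ?_⟩
  have hhalf : (1 / 2 : ℝ) ∈ Icc (1 / 2 : ℝ) 1 := by norm_num
  set b := -Real.log r₂ with hb_def
  set c := Real.log r₂ - Real.log r₁ with hc_def
  have hb : 0 < b := neg_pos.2 (Real.log_neg hr₂.1 hr₂.2)
  have hc : 0 < c := sub_pos.2 (Real.log_lt_log hr₁.1 hlt)
  have hE : ∀ s : ℝ, Real.exp (b * s) * r₂ ^ s = 1 := fun s => by
    rw [Real.rpow_def_of_pos hr₂.1, ← Real.exp_add, hb_def]; ring_nf; exact Real.exp_zero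
  have hu : ∀ s : ℝ, Real.exp (-(c * s)) * r₂ ^ s = r₁ ^ s := fun s => by
    rw [Real.rpow_def_of_pos hr₂.1, Real.rpow_def_of_pos hr₁.1, ← Real.exp_add, hc_def]
    ring_nf
  have hB : ∀ s : ℝ, 0 < r₂ ^ s := fun s => Real.rpow_pos_of_pos hr₂.1 s
  have hquot : ∀ s : ℝ, (1 - Real.exp (b * s) / 2) / (1 - Real.exp (-(c * s)))
      = (r₂ ^ s - 1 / 2) / (r₂ ^ s - r₁ ^ s) := fun s => by
    rw [← mul_div_mul_right _ _ (hB s).ne', sub_mul, sub_mul, hu, div_mul_eq_mul_div, hE, one_mul]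
  have hconv := strictConvexOn_exp_quotient (t := st (1 / 2)) hb hc (by
    refine le_of_mul_le_mul_right ?_ (hB (st (1 / 2)))
    rw [add_mul, hE, hu]
    linarith [hst _ hhalf])
  have hmem : ∀ p ∈ Icc (1 / 2 : ℝ) 1, st p ∈ Ioc 0 (st (1 / 2)) := fun p hp =>
    ⟨hpos p hp, hA.antitoneOn hhalf hp hp.1⟩
  have hinv : ∀ p ∈ Icc (1 / 2 : ℝ) 1,
      (r₂ ^ st p - 1 / 2) / (r₂ ^ st p - r₁ ^ st p) = p := fun p hp => by
    rw [div_eq_iff (sub_pos.2 (hlt' _ (hpos p hp))).ne']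
    linarith [hst p hp]
  have h := hconv.2 (hmem p hp) (hmem q hq) (hA.injOn.ne hp hq hpq) hα hβ hαβ
  have hσ := (convex_Ioc 0 (st (1 / 2))) (hmem p hp) (hmem q hq) hα.le hβ.le hαβ
  have hm := (convex_Icc (1 / 2 : ℝ) 1) hp hq hα.le hβ.le hαβ
  simp only [hquot, hinv p hp, hinv q hq] at h
  rw [div_lt_iff₀ (sub_pos.2 (hlt' _ hσ.1))] at h
  refine (hanti _ hm).lt_iff_gt.1 ?_
  simp only [hst _ hm]
  linarith
end

section
/- Let r_1 < r_2 be in (0,1), and for p ∈ [1/2,1] let s̃(p) be the unique real with p r_1^{s̃(p)} + (1−p) r_2^{s̃(p)} = 1/2. Define g̃(p) := p r_1^{s̃(p)} log(2p) + (1−p) r_2^{s̃(p)} log(2(1−p)). Then g̃ is strictly convex on [1/2, 1]; moreover g̃(1/2) = 0, g̃'(1/2) < 0, and g̃(1) > 0 (where g̃(1) is interpreted via the convention 0·log 0 = 0). Consequently g̃ has a unique zero in the open interval (1/2, 1). -/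
open Set Filter Topology

noncomputable section

/-- The function `g̃(p) = p r₁^{s̃(p)} log(2p) + (1−p) r₂^{s̃(p)} log(2(1−p))`.
(The convention `0 · log 0 = 0` at `p = 1` is automatic since `Real.log 0 = 0`.) -/
def gTilde (r₁ r₂ : ℝ) (st : ℝ → ℝ) (p : ℝ) : ℝ :=
  p * r₁ ^ st p * Real.log (2 * p) + (1 - p) * r₂ ^ st p * Real.log (2 * (1 - p))

/-- Basic estimates for a solution `s` of `p r₁ ^ s + (1 - p) r₂ ^ s = 1 / 2`. -/
lemma rpow_bounds_of_solution {r₁ r₂ p s : ℝ} (hr₁ : r₁ ∈ Ioo (0 : ℝ) 1)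
    (hr₂ : r₂ ∈ Ioo (0 : ℝ) 1) (hlt : r₁ < r₂) (hp : p ∈ Icc (1 / 2 : ℝ) 1)
    (hs : p * r₁ ^ s + (1 - p) * r₂ ^ s = 1 / 2) :
    0 < s ∧ 0 < r₁ ^ s ∧ r₁ ^ s < r₂ ^ s ∧ r₁ ^ s ≤ 1 / 2 ∧ r₂ ^ s < 1 ∧ 1 ≤ r₁ ^ s + r₂ ^ s := by
  obtain ⟨h0, h1⟩ := hr₁
  obtain ⟨h0', h1'⟩ := hr₂
  obtain ⟨hp0, hp1⟩ := hp
  have hs0 : 0 < s := by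
    by_contra! h
    have hA := Real.one_le_rpow_of_pos_of_le_one_of_nonpos h0 h1.le h
    have hB := Real.one_le_rpow_of_pos_of_le_one_of_nonpos h0' h1'.le h
    nlinarith
  have hAB : r₁ ^ s < r₂ ^ s := Real.rpow_lt_rpow h0.le hlt hs0
  refine ⟨hs0, Real.rpow_pos_of_pos h0 s, hAB, by nlinarith,
    Real.rpow_lt_one h0'.le h1' hs0, by nlinarith⟩

lemma continuousOn_of_solution {r₁ r₂ : ℝ} (hr₁ : r₁ ∈ Ioo (0 : ℝ) 1)
    (hr₂ : r₂ ∈ Ioo (0 : ℝ) 1) {st : ℝ → ℝ}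
    (hst : ∀ p ∈ Icc (1 / 2 : ℝ) 1, p * r₁ ^ st p + (1 - p) * r₂ ^ st p = 1 / 2) :
    ContinuousOn st (Icc (1 / 2 : ℝ) 1) := by
  have anti : ∀ p ∈ Icc (1 / 2 : ℝ) 1, ∀ s t : ℝ, s ≤ t →
      p * r₁ ^ t + (1 - p) * r₂ ^ t ≤ p * r₁ ^ s + (1 - p) * r₂ ^ s := by
    intro p hp s t h
    have h1 := Real.rpow_le_rpow_of_exponent_ge hr₁.1 hr₁.2.le h
    have h2 := Real.rpow_le_rpow_of_exponent_ge hr₂.1 hr₂.2.le h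
    have := hp.1
    have := hp.2
    gcongr
  have strictAnti : ∀ p ∈ Icc (1 / 2 : ℝ) 1, ∀ s t : ℝ, s < t →
      p * r₁ ^ t + (1 - p) * r₂ ^ t < p * r₁ ^ s + (1 - p) * r₂ ^ s := by
    intro p hp s t h
    have h1 := Real.rpow_lt_rpow_of_exponent_gt hr₁.1 hr₁.2 h
    have h2 := Real.rpow_lt_rpow_of_exponent_gt hr₂.1 hr₂.2 h
    have hp0 := hp.1
    have hp1 := hp.2
    have : p * r₁ ^ t < p * r₁ ^ s := by gcongr
    have : (1 - p) * r₂ ^ t ≤ (1 - p) * r₂ ^ s := by gcongr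
    linarith
  have cont : ∀ s : ℝ, Continuous fun p : ℝ => p * r₁ ^ s + (1 - p) * r₂ ^ s := by
    intro s; fun_prop
  intro p hp
  refine tendsto_order.2 ⟨fun t ht => ?_, fun t ht => ?_⟩
  · have h := strictAnti p hp t (st p) ht
    rw [hst p hp] at h
    filter_upwards [((cont t).continuousWithinAt.tendsto).eventually_const_lt h,
      self_mem_nhdsWithin] with q hq hqI
    by_contra! hle
    have := anti q hqI _ _ hle
    rw [hst q hqI] at this
    linarith
  · have h := strictAnti p hp (st p) t ht
    rw [hst p hp] at h
    filter_upwards [((cont t).continuousWithinAt.tendsto).eventually_lt_const h,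
      self_mem_nhdsWithin] with q hq hqI
    by_contra! hle
    have := anti q hqI _ _ hle
    rw [hst q hqI] at this
    linarith

lemma hasDerivAt_solution {r₁ r₂ : ℝ} (hr₁ : r₁ ∈ Ioo (0 : ℝ) 1)
    (hr₂ : r₂ ∈ Ioo (0 : ℝ) 1) (hlt : r₁ < r₂) {st : ℝ → ℝ}
    (hst : ∀ p ∈ Icc (1 / 2 : ℝ) 1, p * r₁ ^ st p + (1 - p) * r₂ ^ st p = 1 / 2)
    {p : ℝ} (hp : p ∈ Ioo (1 / 2 : ℝ) 1) :
    HasDerivAt st ((r₂ ^ st p - r₁ ^ st p) /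
      (p * Real.log r₁ * r₁ ^ st p + (1 - p) * Real.log r₂ * r₂ ^ st p)) p := by
  have hpI := Ioo_subset_Icc_self hp
  have hnhds : Icc (1 / 2 : ℝ) 1 ∈ 𝓝 p := Icc_mem_nhds hp.1 hp.2
  obtain ⟨hs0, hA0, hAB, -, -, -⟩ := rpow_bounds_of_solution hr₁ hr₂ hlt hpI (hst p hpI)
  have hBA : r₂ ^ st p - r₁ ^ st p ≠ 0 := by linarith
  have hl₁ := Real.log_neg hr₁.1 hr₁.2
  have hl₂ := Real.log_neg hr₂.1 hr₂.2
  have hden : p * Real.log r₁ * r₁ ^ st p + (1 - p) * Real.log r₂ * r₂ ^ st p < 0 := by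
    have h1 : 0 < p * r₁ ^ st p := mul_pos (by linarith [hp.1]) hA0
    have h2 : 0 < (1 - p) * r₂ ^ st p := mul_pos (by linarith [hp.2]) (by linarith)
    nlinarith [mul_neg_of_pos_of_neg h1 hl₁, mul_neg_of_pos_of_neg h2 hl₂]
  have d₁ : HasDerivAt (fun s : ℝ => r₁ ^ s) (r₁ ^ st p * Real.log r₁) (st p) :=
    (Real.hasStrictDerivAt_const_rpow hr₁.1 _).hasDerivAt
  have d₂ : HasDerivAt (fun s : ℝ => r₂ ^ s) (r₂ ^ st p * Real.log r₂) (st p) :=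
    (Real.hasStrictDerivAt_const_rpow hr₂.1 _).hasDerivAt
  have d := (d₂.sub_const (1 / 2)).div (d₂.sub d₁) hBA
  have hB : r₂ ^ st p - 1 / 2 = p * (r₂ ^ st p - r₁ ^ st p) := by linarith [hst p hpI]
  have d' : HasDerivAt (fun s : ℝ => (r₂ ^ s - 1 / 2) / (r₂ ^ s - r₁ ^ s))
      ((p * Real.log r₁ * r₁ ^ st p + (1 - p) * Real.log r₂ * r₂ ^ st p) /
        (r₂ ^ st p - r₁ ^ st p)) (st p) := by
    refine d.congr_deriv ?_
    simp only [Pi.sub_apply]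
    rw [hB]
    field_simp
    ring
  rw [← inv_div]
  refine d'.of_local_left_inverse ((continuousOn_of_solution hr₁ hr₂ hst).continuousAt hnhds)
    (div_ne_zero hden.ne hBA) ?_
  filter_upwards [hnhds] with q hq
  obtain ⟨-, -, hAB', -⟩ := rpow_bounds_of_solution hr₁ hr₂ hlt hq (hst q hq)
  rw [div_eq_iff (by linarith)]
  linarith [hst q hq]

lemma continuousOn_gTilde {r₁ r₂ : ℝ} (hr₁ : 0 < r₁) (hr₂ : 0 < r₂) {st : ℝ → ℝ} {S : Set ℝ}
    (hS : ∀ p ∈ S, p ≠ 0) (hc : ContinuousOn st S) : ContinuousOn (gTilde r₁ r₂ st) S := by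
  have h₁ : ContinuousOn (fun p => r₁ ^ st p) S := continuousOn_const.rpow hc fun _ _ => Or.inl hr₁.ne'
  have h₂ : ContinuousOn (fun p => r₂ ^ st p) S := continuousOn_const.rpow hc fun _ _ => Or.inl hr₂.ne'
  have h₃ : Continuous fun p : ℝ => 2 * (1 - p) * Real.log (2 * (1 - p)) :=
    Real.continuous_mul_log.comp (by fun_prop : Continuous fun p : ℝ => 2 * (1 - p))
  have h₄ : ContinuousOn (fun p : ℝ => Real.log (2 * p)) S :=
    ContinuousOn.log (by fun_prop) fun p hp => mul_ne_zero two_ne_zero (hS p hp)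
  refine (((continuousOn_id.mul h₁).mul h₄).add
    ((h₂.mul h₃.continuousOn).div_const 2)).congr fun p _ => ?_
  simp only [gTilde, id, Pi.add_apply, Pi.mul_apply]
  ring

/-- The reciprocal of the derivative of `p ↦ p r₁ ^ st p`. -/
def recipDeriv (r₁ r₂ : ℝ) (st : ℝ → ℝ) (p : ℝ) : ℝ :=
  (p * Real.log r₁ / r₂ ^ st p + (1 - p) * Real.log r₂ / r₁ ^ st p) /
    (p * Real.log r₁ + (1 - p) * Real.log r₂)

/-- The derivative of `gTilde` on the open interval. -/
def gTildeDeriv (r₁ r₂ : ℝ) (st : ℝ → ℝ) (p : ℝ) : ℝ :=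
  (Real.log (2 * p) - Real.log (2 * (1 - p))) / recipDeriv r₁ r₂ st p + r₁ ^ st p - r₂ ^ st p

lemma recipDeriv_pos {r₁ r₂ : ℝ} (hr₁ : r₁ ∈ Ioo (0 : ℝ) 1) (hr₂ : r₂ ∈ Ioo (0 : ℝ) 1)
    (st : ℝ → ℝ) {p : ℝ} (hp : p ∈ Ioo (0 : ℝ) 1) : 0 < recipDeriv r₁ r₂ st p := by
  have hl₁ := Real.log_neg hr₁.1 hr₁.2
  have hl₂ := Real.log_neg hr₂.1 hr₂.2
  have h₁ := mul_neg_of_pos_of_neg hp.1 hl₁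
  have h₂ := mul_neg_of_pos_of_neg (sub_pos.2 hp.2) hl₂
  exact div_pos_of_neg_of_neg (add_neg (div_neg_of_neg_of_pos h₁ (Real.rpow_pos_of_pos hr₂.1 _))
    (div_neg_of_neg_of_pos h₂ (Real.rpow_pos_of_pos hr₁.1 _))) (add_neg h₁ h₂)

lemma hasDerivAt_gTilde {r₁ r₂ : ℝ} (hr₁ : r₁ ∈ Ioo (0 : ℝ) 1)
    (hr₂ : r₂ ∈ Ioo (0 : ℝ) 1) (hlt : r₁ < r₂) {st : ℝ → ℝ}
    (hst : ∀ p ∈ Icc (1 / 2 : ℝ) 1, p * r₁ ^ st p + (1 - p) * r₂ ^ st p = 1 / 2)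
    {p : ℝ} (hp : p ∈ Ioo (1 / 2 : ℝ) 1) :
    HasDerivAt (gTilde r₁ r₂ st) (gTildeDeriv r₁ r₂ st p) p := by
  have hs := hasDerivAt_solution hr₁ hr₂ hlt hst hp
  have hp0 : 0 < p := by linarith [hp.1]
  have hp1 : 0 < 1 - p := by linarith [hp.2]
  have hA := Real.rpow_pos_of_pos hr₁.1 (st p)
  have hB := Real.rpow_pos_of_pos hr₂.1 (st p)
  have hl₁ := Real.log_neg hr₁.1 hr₁.2
  have hl₂ := Real.log_neg hr₂.1 hr₂.2
  have hm₁ := mul_neg_of_pos_of_neg hp0 hl₁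
  have hm₂ := mul_neg_of_pos_of_neg hp1 hl₂
  have hden := (add_neg (mul_neg_of_neg_of_pos hm₁ hA) (mul_neg_of_neg_of_pos hm₂ hB)).ne
  have hM := (add_neg hm₁ hm₂).ne
  have d₁ := hs.const_rpow hr₁.1
  have d₂ := hs.const_rpow hr₂.1
  have dq : HasDerivAt (fun q : ℝ => 1 - q) (-1) p := (hasDerivAt_id p).const_sub 1
  have dl₁ := ((hasDerivAt_id p).const_mul 2).log (by simpa using hp0.ne')
  have dl₂ := (dq.const_mul 2).log (by positivity)
  have d := (((hasDerivAt_id p).mul d₁).mul dl₁).add ((dq.mul d₂).mul dl₂)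
  refine d.congr_deriv ?_
  simp only [gTildeDeriv, recipDeriv, Pi.mul_apply, id]
  generalize r₁ ^ st p = A at *
  generalize r₂ ^ st p = B at *
  generalize Real.log (2 * p) = L₁
  generalize Real.log (2 * (1 - p)) = L₂
  generalize Real.log r₁ = a at *
  generalize Real.log r₂ = b at *
  have hN : p * a / B + (1 - p) * b / A = (p * a * A + (1 - p) * b * B) / (A * B) := by
    field_simp
  rw [hN]
  generalize hD : p * a * A + (1 - p) * b * B = D at *
  field_simp
  rw [← hD]
  ring

lemma hasDerivAt_recipDeriv {r₁ r₂ : ℝ} (hr₁ : r₁ ∈ Ioo (0 : ℝ) 1)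
    (hr₂ : r₂ ∈ Ioo (0 : ℝ) 1) (hlt : r₁ < r₂) {st : ℝ → ℝ}
    (hst : ∀ p ∈ Icc (1 / 2 : ℝ) 1, p * r₁ ^ st p + (1 - p) * r₂ ^ st p = 1 / 2)
    {p : ℝ} (hp : p ∈ Ioo (1 / 2 : ℝ) 1) :
    ∃ Y' ≤ 0, HasDerivAt (recipDeriv r₁ r₂ st) Y' p := by
  have hs := hasDerivAt_solution hr₁ hr₂ hlt hst hp
  have hpI := Ioo_subset_Icc_self hp
  obtain ⟨-, -, hAB, -, -, -⟩ := rpow_bounds_of_solution hr₁ hr₂ hlt hpI (hst p hpI)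
  have hp0 : 0 < p := by linarith [hp.1]
  have hp1 : 0 < 1 - p := by linarith [hp.2]
  have hA := Real.rpow_pos_of_pos hr₁.1 (st p)
  have hB := Real.rpow_pos_of_pos hr₂.1 (st p)
  have hl₁ := Real.log_neg hr₁.1 hr₁.2
  have hl₂ := Real.log_neg hr₂.1 hr₂.2
  have hm₁ := mul_neg_of_pos_of_neg hp0 hl₁
  have hm₂ := mul_neg_of_pos_of_neg hp1 hl₂
  have hden := add_neg (mul_neg_of_neg_of_pos hm₁ hA) (mul_neg_of_neg_of_pos hm₂ hB)
  have hM := (add_neg hm₁ hm₂).ne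
  have hs' := div_neg_of_pos_of_neg (sub_pos.2 hAB) hden
  have d₁ := hs.const_rpow hr₁.1
  have d₂ := hs.const_rpow hr₂.1
  generalize (r₂ ^ st p - r₁ ^ st p) /
      (p * Real.log r₁ * r₁ ^ st p + (1 - p) * Real.log r₂ * r₂ ^ st p) = s' at *
  have dq : HasDerivAt (fun q : ℝ => 1 - q) (-1) p := (hasDerivAt_id p).const_sub 1
  have e₁ := (hasDerivAt_id p).mul_const (Real.log r₁)
  have e₂ := dq.mul_const (Real.log r₂)
  have d := ((e₁.div d₂ hB.ne').add (e₂.div d₁ hA.ne')).div (e₁.add e₂) hM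
  refine ⟨_, ?_, d⟩
  refine div_nonpos_of_nonpos_of_nonneg ?_ (sq_nonneg _)
  simp only [Pi.add_apply, Pi.div_apply, id]
  generalize r₁ ^ st p = A at *
  generalize r₂ ^ st p = B at *
  generalize Real.log r₁ = a at *
  generalize Real.log r₂ = b at *
  have key : a * b * (1 / B - 1 / A) -
      a * b * s' * (p / B + (1 - p) / A) * (p * a + (1 - p) * b) ≤ 0 := by
    have hab : 0 < a * b := mul_pos_of_neg_of_neg hl₁ hl₂
    have h1 : 1 / B - 1 / A ≤ 0 := sub_nonpos.2 (one_div_le_one_div_of_le hA hAB.le)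
    have h2 : 0 < p / B + (1 - p) / A := by positivity
    have h3 := mul_nonpos_of_nonneg_of_nonpos hab.le h1
    have h4 := mul_pos_of_neg_of_neg
      (mul_neg_of_neg_of_pos (mul_neg_of_pos_of_neg hab hs') h2) (add_neg hm₁ hm₂)
    linarith
  refine le_of_eq_of_le ?_ key
  field_simp
  ring

/-- The inequality behind the positivity of the second derivative of `gTilde`; here `A`, `B` stand
for `r₁ ^ s`, `r₂ ^ s`, and `a`, `b` for `log r₁`, `log r₂`. -/
lemma second_derivative_aux {a b A B p s : ℝ} (hs : 0 < s) (hA : 0 < A) (hAB : A < B)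
    (hA2 : A ≤ 1 / 2) (hsum : 1 ≤ A + B) (hp : p ∈ Ioo (1 / 2 : ℝ) 1)
    (ha : Real.log A = s * a) (hb : Real.log B = s * b) (hb0 : b < 0) :
    0 < -a * A * (B / (1 - p) + B - A) - b * B * (A / p + A - B) := by
  have hB : 0 < B := hA.trans hAB
  have hp1 : 0 < 1 - p := by linarith [hp.2]
  have hp0 : 0 < p := by linarith [hp.1]
  have h1 : 2 / 3 < -(s * a) := by
    have := Real.log_le_log hA hA2
    rw [one_div, Real.log_inv] at this
    linarith [Real.log_two_gt_d9]
  have h2 : -(s * b) * B ≤ A := by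
    have := Real.one_sub_inv_le_log_of_pos hB
    rw [hb] at this
    have := mul_le_mul_of_nonneg_right this hB.le
    rw [sub_mul, inv_mul_cancel₀ hB.ne'] at this
    linarith
  have h3 : 2 * B ≤ B / (1 - p) := by
    rw [le_div_iff₀ hp1]
    nlinarith [hp.1]
  have h4 : 0 < A / p := by positivity
  have h5 : 2 / 3 * A * (3 * B - A) ≤ -(s * a) * A * (B / (1 - p) + B - A) := by
    gcongr
    · linarith
    · linarith
  have h6 : -(s * b) * B * (B - A - A / p) ≤ A * B := by
    have h0 : 0 ≤ -(s * b) * B := mul_nonneg (by nlinarith) hB.le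
    calc _ ≤ -(s * b) * B * B := by gcongr; linarith
      _ ≤ A * B := by gcongr
  have h7 : A * B < 2 / 3 * A * (3 * B - A) := by nlinarith [mul_lt_mul_of_pos_left hAB hA]
  refine (mul_pos_iff_of_pos_left hs).1 ?_
  nlinarith

lemma hasDerivAt_gTildeDeriv {r₁ r₂ : ℝ} (hr₁ : r₁ ∈ Ioo (0 : ℝ) 1)
    (hr₂ : r₂ ∈ Ioo (0 : ℝ) 1) (hlt : r₁ < r₂) {st : ℝ → ℝ}
    (hst : ∀ p ∈ Icc (1 / 2 : ℝ) 1, p * r₁ ^ st p + (1 - p) * r₂ ^ st p = 1 / 2)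
    {p : ℝ} (hp : p ∈ Ioo (1 / 2 : ℝ) 1) :
    ∃ G' > 0, HasDerivAt (gTildeDeriv r₁ r₂ st) G' p := by
  have hs := hasDerivAt_solution hr₁ hr₂ hlt hst hp
  have hpI := Ioo_subset_Icc_self hp
  obtain ⟨hs0, -, hAB, hA2, -, hsum⟩ := rpow_bounds_of_solution hr₁ hr₂ hlt hpI (hst p hpI)
  obtain ⟨Y', hY', dY⟩ := hasDerivAt_recipDeriv hr₁ hr₂ hlt hst hp
  have hp0 : 0 < p := by linarith [hp.1]
  have hp1 : 0 < 1 - p := by linarith [hp.2]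
  have hY := recipDeriv_pos hr₁ hr₂ st ⟨hp0, hp.2⟩
  have hA := Real.rpow_pos_of_pos hr₁.1 (st p)
  have hB := Real.rpow_pos_of_pos hr₂.1 (st p)
  have hl₁ := Real.log_neg hr₁.1 hr₁.2
  have hl₂ := Real.log_neg hr₂.1 hr₂.2
  have hm₁ := mul_neg_of_pos_of_neg hp0 hl₁
  have hm₂ := mul_neg_of_pos_of_neg hp1 hl₂
  have hden := add_neg (mul_neg_of_neg_of_pos hm₁ hA) (mul_neg_of_neg_of_pos hm₂ hB)
  have hM := (add_neg hm₁ hm₂).ne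
  have hL : 0 ≤ Real.log (2 * p) - Real.log (2 * (1 - p)) :=
    sub_nonneg.2 (Real.log_le_log (by positivity) (by linarith [hp.1]))
  have key := second_derivative_aux hs0 hA hAB hA2 hsum hp (Real.log_rpow hr₁.1 _)
    (Real.log_rpow hr₂.1 _) hl₂
  have dq : HasDerivAt (fun q : ℝ => 1 - q) (-1) p := (hasDerivAt_id p).const_sub 1
  have dl₁ := ((hasDerivAt_id p).const_mul 2).log (by simpa using hp0.ne')
  have dl₂ := (dq.const_mul 2).log (by positivity)
  have d := (((dl₁.sub dl₂).div dY hY.ne').add (hs.const_rpow hr₁.1)).sub (hs.const_rpow hr₂.1)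
  refine ⟨_, ?_, d⟩
  simp only [Pi.sub_apply, id]
  generalize hYv : recipDeriv r₁ r₂ st p = Y at *
  rw [recipDeriv] at hYv
  generalize r₁ ^ st p = A at *
  generalize r₂ ^ st p = B at *
  generalize Real.log (2 * p) = L₁ at *
  generalize Real.log (2 * (1 - p)) = L₂ at *
  generalize Real.log r₁ = a at *
  generalize Real.log r₂ = b at *
  have h1 : 0 ≤ -((L₁ - L₂) * Y') / Y ^ 2 :=
    div_nonneg (neg_nonneg.2 (mul_nonpos_of_nonneg_of_nonpos hL hY')) (sq_nonneg _)
  have hN : p * a / B + (1 - p) * b / A = (p * a * A + (1 - p) * b * B) / (A * B) := by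
    field_simp
  rw [hN] at hYv
  have h2 := div_pos key (neg_pos.2 hden)
  generalize hD : p * a * A + (1 - p) * b * B = D at *
  have hD0 := hden.ne
  have h3 := add_pos_of_pos_of_nonneg h2 h1
  refine h3.trans_eq (Eq.symm ?_)
  have hY0 := hY.ne'
  have hYi : Y⁻¹ = A * B * (p * a + (1 - p) * b) / D := by
    rw [← hYv]; field_simp
  have hsplit : ((2 * 1 / (2 * p) - 2 * -1 / (2 * (1 - p))) * Y - (L₁ - L₂) * Y') / Y ^ 2 =
      (1 / p + 1 / (1 - p)) * Y⁻¹ + -((L₁ - L₂) * Y') / Y ^ 2 := by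
    field_simp
    ring
  rw [hsplit, hYi]
  generalize -((L₁ - L₂) * Y') / Y ^ 2 = Z
  field_simp
  ring

lemma strictConvexOn_gTilde {r₁ r₂ : ℝ} (hr₁ : r₁ ∈ Ioo (0 : ℝ) 1)
    (hr₂ : r₂ ∈ Ioo (0 : ℝ) 1) (hlt : r₁ < r₂) {st : ℝ → ℝ}
    (hst : ∀ p ∈ Icc (1 / 2 : ℝ) 1, p * r₁ ^ st p + (1 - p) * r₂ ^ st p = 1 / 2) :
    StrictConvexOn ℝ (Icc (1 / 2 : ℝ) 1) (gTilde r₁ r₂ st) := by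
  refine strictConvexOn_of_deriv2_pos (convex_Icc _ _)
    (continuousOn_gTilde hr₁.1 hr₂.1 (fun p hp => by linarith [hp.1])
      (continuousOn_of_solution hr₁ hr₂ hst)) fun p hp => ?_
  rw [interior_Icc] at hp
  obtain ⟨G', hG', dG⟩ := hasDerivAt_gTildeDeriv hr₁ hr₂ hlt hst hp
  have heq : deriv (gTilde r₁ r₂ st) =ᶠ[𝓝 p] gTildeDeriv r₁ r₂ st := by
    filter_upwards [Ioo_mem_nhds hp.1 hp.2] with q hq
    exact (hasDerivAt_gTilde hr₁ hr₂ hlt hst hq).deriv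
  simpa [heq.deriv_eq, dG.deriv] using hG'

lemma hasDerivWithinAt_gTilde_half {r₁ r₂ : ℝ} (hr₁ : r₁ ∈ Ioo (0 : ℝ) 1)
    (hr₂ : r₂ ∈ Ioo (0 : ℝ) 1) (hlt : r₁ < r₂) {st : ℝ → ℝ}
    (hst : ∀ p ∈ Icc (1 / 2 : ℝ) 1, p * r₁ ^ st p + (1 - p) * r₂ ^ st p = 1 / 2) :
    HasDerivWithinAt (gTilde r₁ r₂ st) (r₁ ^ st (1 / 2) - r₂ ^ st (1 / 2))
      (Icc (1 / 2 : ℝ) 1) (1 / 2) := by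
  have hhalf : (1 / 2 : ℝ) ∈ Icc (1 / 2 : ℝ) 1 := by norm_num
  have hc := continuousOn_of_solution hr₁ hr₂ hst
  have hcw : ContinuousWithinAt st (Ioo (1 / 2 : ℝ) 1) (1 / 2) :=
    (hc _ hhalf).mono Ioo_subset_Icc_self
  refine (hasDerivWithinAt_Ici_of_tendsto_deriv (s := Ioo (1 / 2 : ℝ) 1)
    (fun p hp => (hasDerivAt_gTilde hr₁ hr₂ hlt hst hp).differentiableAt.differentiableWithinAt)
    ((continuousOn_gTilde hr₁.1 hr₂.1 (fun p hp => by linarith [hp.1]) hc _ hhalf).mono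
      Ioo_subset_Icc_self) (Ioo_mem_nhdsGT (by norm_num)) ?_).mono Icc_subset_Ici_self
  have hA := (continuousWithinAt_const (b := r₁)).rpow hcw (Or.inl hr₁.1.ne')
  have hB := (continuousWithinAt_const (b := r₂)).rpow hcw (Or.inl hr₂.1.ne')
  have hid : ContinuousWithinAt (fun p : ℝ => p) (Ioo (1 / 2 : ℝ) 1) (1 / 2) :=
    continuousWithinAt_id
  have hq : ContinuousWithinAt (fun p : ℝ => 1 - p) (Ioo (1 / 2 : ℝ) 1) (1 / 2) :=
    continuousWithinAt_const.sub hid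
  have hl₁ := Real.log_neg hr₁.1 hr₁.2
  have hl₂ := Real.log_neg hr₂.1 hr₂.2
  have hY : ContinuousWithinAt (recipDeriv r₁ r₂ st) (Ioo (1 / 2 : ℝ) 1) (1 / 2) :=
    (((hid.mul continuousWithinAt_const).div hB (Real.rpow_pos_of_pos hr₂.1 _).ne').add
      ((hq.mul continuousWithinAt_const).div hA (Real.rpow_pos_of_pos hr₁.1 _).ne')).div
      ((hid.mul continuousWithinAt_const).add (hq.mul continuousWithinAt_const)) (by
        linarith)
  have hG : ContinuousWithinAt (gTildeDeriv r₁ r₂ st) (Ioo (1 / 2 : ℝ) 1) (1 / 2) :=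
    (((((continuousWithinAt_const.mul hid).log (by norm_num)).sub
      ((continuousWithinAt_const.mul hq).log (by norm_num))).div hY
        (recipDeriv_pos hr₁ hr₂ st (by norm_num)).ne').add hA).sub hB
  have hval : gTildeDeriv r₁ r₂ st (1 / 2) = r₁ ^ st (1 / 2) - r₂ ^ st (1 / 2) := by
    norm_num [gTildeDeriv]
  have ht := hG.tendsto
  rw [hval, nhdsWithin_Ioo_eq_nhdsGT (by norm_num)] at ht
  refine ht.congr' ?_
  filter_upwards [Ioo_mem_nhdsGT (show (1 / 2 : ℝ) < 1 by norm_num)] with p hp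
  exact (hasDerivAt_gTilde hr₁ hr₂ hlt hst hp).deriv.symm

/-- A strictly convex function vanishing at `a` with negative derivative there, and positive
at `b > a`, has exactly one zero in `(a, b)`. -/
lemma StrictConvexOn.existsUnique_zero {f : ℝ → ℝ} {a b D : ℝ} (hab : a < b)
    (hf : StrictConvexOn ℝ (Icc a b) f) (hc : ContinuousOn f (Icc a b)) (ha : f a = 0)
    (hD : HasDerivWithinAt f D (Icc a b) a) (hD0 : D < 0) (hb : 0 < f b) :
    ∃! q : ℝ, q ∈ Ioo a b ∧ f q = 0 := by
  have hneg : ∀ᶠ x in 𝓝[>] a, slope f a x < 0 := by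
    have h := hasDerivWithinAt_iff_tendsto_slope.1 hD
    rw [Icc_sdiff_left, nhdsWithin_Ioc_eq_nhdsGT hab] at h
    exact h.eventually_lt_const hD0
  obtain ⟨x, hx, hxI⟩ := (hneg.and (Ioo_mem_nhdsGT hab)).exists
  have hfx : f x < 0 := by
    rw [slope_def_field, ha, sub_zero] at hx
    have := sub_pos.2 hxI.1
    by_contra! h
    exact hx.not_ge (div_nonneg h this.le)
  obtain ⟨q, hq, hq0⟩ := intermediate_value_Ioo hxI.2.le
    (hc.mono (Icc_subset_Icc_left hxI.1.le)) ⟨hfx, hb⟩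
  have no_two : ∀ y z, a < y → y < z → z < b → f y = 0 → f z = 0 → False := by
    intro y z hay hyz hzb hy hz
    have h := hf.slope_strict_mono_adjacent ⟨le_rfl, hab.le⟩
      ⟨(hay.trans hyz).le, hzb.le⟩ hay hyz
    simp [ha, hy, hz] at h
  refine ⟨q, ⟨⟨hxI.1.trans hq.1, hq.2⟩, hq0⟩, fun z hz => ?_⟩
  rcases lt_trichotomy z q with h | h | h
  · exact (no_two z q hz.1.1 h hq.2 hz.2 hq0).elim
  · exact h
  · exact (no_two q z (hxI.1.trans hq.1) h hz.1.2 hq0 hz.2).elim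

theorem gTilde_convex_and_unique_zero
    (r₁ r₂ : ℝ) (hr₁ : r₁ ∈ Ioo (0 : ℝ) 1) (hr₂ : r₂ ∈ Ioo (0 : ℝ) 1) (hlt : r₁ < r₂)
    (st : ℝ → ℝ)
    (hst : ∀ p ∈ Icc (1 / 2 : ℝ) 1, p * r₁ ^ st p + (1 - p) * r₂ ^ st p = 1 / 2) :
    StrictConvexOn ℝ (Icc (1 / 2 : ℝ) 1) (gTilde r₁ r₂ st) ∧
    gTilde r₁ r₂ st (1 / 2) = 0 ∧
    (∃ D : ℝ, HasDerivWithinAt (gTilde r₁ r₂ st) D (Icc (1 / 2 : ℝ) 1) (1 / 2) ∧ D < 0) ∧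
    0 < gTilde r₁ r₂ st 1 ∧
    ∃! q : ℝ, q ∈ Ioo (1 / 2 : ℝ) 1 ∧ gTilde r₁ r₂ st q = 0 := by
  have hhalf : (1 / 2 : ℝ) ∈ Icc (1 / 2 : ℝ) 1 := by norm_num
  have hone : (1 : ℝ) ∈ Icc (1 / 2 : ℝ) 1 := by norm_num
  have hconv := strictConvexOn_gTilde hr₁ hr₂ hlt hst
  have hzero : gTilde r₁ r₂ st (1 / 2) = 0 := by norm_num [gTilde]
  have hD := hasDerivWithinAt_gTilde_half hr₁ hr₂ hlt hst
  have hD0 : r₁ ^ st (1 / 2) - r₂ ^ st (1 / 2) < 0 :=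
    sub_neg.2 (rpow_bounds_of_solution hr₁ hr₂ hlt hhalf (hst _ hhalf)).2.2.1
  have hpos : 0 < gTilde r₁ r₂ st 1 := by
    have h := (rpow_bounds_of_solution hr₁ hr₂ hlt hone (hst _ hone)).2.1
    simpa [gTilde] using mul_pos h (Real.log_pos one_lt_two)
  exact ⟨hconv, hzero, ⟨_, hD, hD0⟩, hpos, hconv.existsUnique_zero (by norm_num)
    (continuousOn_gTilde hr₁.1 hr₂.1 (fun p hp => by linarith [hp.1])
      (continuousOn_of_solution hr₁ hr₂ hst)) hzero hD hD0 hpos⟩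
end
end

section
/- Let N ≥ 2 and r_1,…,r_N ∈ (0,1), and let s_0 be the unique real with Σ_{i=1}^N r_i^{s_0} = 1. Then max{ ψ(x) : x ∈ [0,∞)^N, h(x) = 1 } = s_0, and the maximum is attained uniquely at the point β = (β_1,…,β_N) with β_i = −r_i^{s_0} / (Σ_{j=1}^N r_j^{s_0} log r_j) for i = 1,…,N. -/
open Set

noncomputable section

/-- `ψ(x) = Σ x_i (log Σ_j x_j − log x_i)` (with `0 log 0 = 0`, via `Real.log 0 = 0`). -/
def psiFn (N : ℕ) (x : Fin N → ℝ) : ℝ :=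
  ∑ i, x i * (Real.log (∑ j, x j) - Real.log (x i))

/-- `φ(x) = Σ x_i log (M p_i)`. -/
def phiFn (N M : ℕ) (p : Fin N → ℝ) (x : Fin N → ℝ) : ℝ :=
  ∑ i, x i * Real.log (M * p i)

/-- `h(x) = −Σ x_i log r_i`. -/
def hFn (N : ℕ) (r : Fin N → ℝ) (x : Fin N → ℝ) : ℝ :=
  -∑ i, x i * Real.log (r i)

theorem mul_log_add_mul_log_le {x S p : ℝ} (hx : 0 ≤ x) (hS : 0 < S) (hp : 0 < p) :
    x * (Real.log S - Real.log x) + x * Real.log p ≤ S * p - x := by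
  rcases hx.eq_or_lt with rfl | hx
  · simp only [zero_mul, add_zero, sub_zero]
    positivity
  · have h := Real.log_le_sub_one_of_pos (show 0 < S * p / x by positivity)
    rw [Real.log_div (by positivity) hx.ne', Real.log_mul hS.ne' hp.ne'] at h
    have h' := mul_le_mul_of_nonneg_left h hx.le
    have e : x * (S * p / x - 1) = S * p - x := by field_simp
    linarith

theorem eq_mul_of_mul_log_add_mul_log_eq {x S p : ℝ} (hx : 0 ≤ x) (hS : 0 < S) (hp : 0 < p)
    (h : x * (Real.log S - Real.log x) + x * Real.log p = S * p - x) : x = S * p := by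
  rcases hx.eq_or_lt with rfl | hx
  · simpa using h
  · by_contra hne
    have hlt := Real.log_lt_sub_one_of_pos (show 0 < S * p / x by positivity)
      (fun h1 => hne ((div_eq_one_iff_eq hx.ne').1 h1).symm)
    rw [Real.log_div (by positivity) hx.ne', Real.log_mul hS.ne' hp.ne'] at hlt
    have h' := mul_lt_mul_of_pos_left hlt hx
    have e : x * (S * p / x - 1) = S * p - x := by field_simp
    linarith

theorem max_psi_on_hyperplane
    {N : ℕ} (hN : 2 ≤ N) (r : Fin N → ℝ) (hr : ∀ i, r i ∈ Ioo (0 : ℝ) 1)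
    (s₀ : ℝ) (hs₀ : ∑ i, r i ^ s₀ = 1) :
    ∃ β : Fin N → ℝ,
      (∀ i, β i = -(r i ^ s₀) / ∑ j, r j ^ s₀ * Real.log (r j)) ∧
      (∀ i, 0 ≤ β i) ∧ hFn N r β = 1 ∧ psiFn N β = s₀ ∧
      (∀ x : Fin N → ℝ, (∀ i, 0 ≤ x i) → hFn N r x = 1 → psiFn N x ≤ s₀) ∧
      (∀ x : Fin N → ℝ, (∀ i, 0 ≤ x i) → hFn N r x = 1 → psiFn N x = s₀ → x = β) := by
  have hp : ∀ i, 0 < r i ^ s₀ := fun i => Real.rpow_pos_of_pos (hr i).1 _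
  have hlog : ∀ i, Real.log (r i) < 0 := fun i => Real.log_neg (hr i).1 (hr i).2
  have hlogp : ∀ i, Real.log (r i ^ s₀) = s₀ * Real.log (r i) :=
    fun i => Real.log_rpow (hr i).1 _
  set D := ∑ j, r j ^ s₀ * Real.log (r j) with hD
  have hDneg : D < 0 :=
    Finset.sum_neg (fun i _ => mul_neg_of_pos_of_neg (hp i) (hlog i)) ⟨⟨0, by omega⟩, by simp⟩
  have hsum_pos : ∀ x : Fin N → ℝ, (∀ i, 0 ≤ x i) → hFn N r x = 1 → 0 < ∑ j, x j := by
    intro x hx hh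
    refine (Finset.sum_nonneg fun i _ => hx i).lt_of_ne' fun h0 => ?_
    have hz := (Finset.sum_eq_zero_iff_of_nonneg fun i _ => hx i).1 h0
    simp [hFn, fun i => hz i (Finset.mem_univ i)] at hh
  have hleft : ∀ x : Fin N → ℝ, hFn N r x = 1 →
      ∑ i, (x i * (Real.log (∑ j, x j) - Real.log (x i)) + x i * Real.log (r i ^ s₀)) =
        psiFn N x - s₀ := by
    intro x hh
    have e : ∑ i, x i * Real.log (r i ^ s₀) = s₀ * ∑ i, x i * Real.log (r i) := by
      rw [Finset.mul_sum]
      exact Finset.sum_congr rfl fun i _ => by rw [hlogp]; ring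
    have hh' : ∑ i, x i * Real.log (r i) = -1 := by
      unfold hFn at hh
      linarith
    rw [Finset.sum_add_distrib, e, hh', psiFn]
    ring
  have hright : ∀ x : Fin N → ℝ, ∑ i, ((∑ j, x j) * r i ^ s₀ - x i) = 0 := by
    intro x
    rw [Finset.sum_sub_distrib, ← Finset.mul_sum, hs₀]
    ring
  have hβ : ∀ i, -(r i ^ s₀) / D = (-1 / D) * r i ^ s₀ := fun i => by ring
  have hc : 0 < -1 / D := div_pos_of_neg_of_neg (by norm_num) hDneg
  have hhβ : hFn N r (fun i => -(r i ^ s₀) / D) = 1 := by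
    simp only [hFn, hβ, mul_assoc]
    rw [← Finset.mul_sum, ← hD]
    field_simp [hDneg.ne]
  refine ⟨fun i => -(r i ^ s₀) / D, fun i => rfl, fun i => ?_, hhβ, ?_, ?_, ?_⟩
  · simp only [hβ]
    exact (mul_pos hc (hp i)).le
  · have h := hleft _ hhβ
    have hz : ∀ i, (-1 / D) * r i ^ s₀ * (Real.log (-1 / D) - Real.log ((-1 / D) * r i ^ s₀)) +
        (-1 / D) * r i ^ s₀ * Real.log (r i ^ s₀) = 0 := by
      intro i
      rw [Real.log_mul hc.ne' (hp i).ne']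
      ring
    have hs : ∑ i, (-1 / D) * r i ^ s₀ = -1 / D := by rw [← Finset.mul_sum, hs₀, mul_one]
    simp only [hβ, hs, hz, Finset.sum_const_zero] at h ⊢
    linarith
  · intro x hx hh
    have h := Finset.sum_le_sum fun i (_ : i ∈ Finset.univ) =>
      mul_log_add_mul_log_le (hx i) (hsum_pos x hx hh) (hp i)
    rw [hleft x hh, hright] at h
    linarith
  · intro x hx hh hψ
    have hS := hsum_pos x hx hh
    have hx_eq : ∀ i, x i = (∑ j, x j) * r i ^ s₀ := by
      intro i
      refine eq_mul_of_mul_log_add_mul_log_eq (hx i) hS (hp i) ?_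
      refine (Finset.sum_eq_sum_iff_of_le fun i _ => mul_log_add_mul_log_le (hx i) hS (hp i)).1
        ?_ i (Finset.mem_univ i)
      rw [hleft x hh, hright, hψ, sub_self]
    have hSD : (∑ j, x j) * D = -1 := by
      have e : ∑ i, x i * Real.log (r i) = (∑ j, x j) * D := by
        rw [hD, Finset.mul_sum]
        exact Finset.sum_congr rfl fun i _ => by rw [← mul_assoc, ← hx_eq i]
      unfold hFn at hh
      linarith
    funext i
    rw [hβ, ← hSD, mul_div_cancel_right₀ _ hDneg.ne]
    exact hx_eq i
end
end

section
/- Let N ≥ 2, r_1,…,r_N ∈ (0,1), M ≥ 2 an integer, p = (p_1,…,p_N) ∈ (0,1)^N a probability vector, and let s̃ be the unique real with Σ_{i=1}^N p_i r_i^{s̃} = 1/M. Then max{ ψ(x) + φ(x) : x ∈ [0,∞)^N, h(x) = 1 } = s̃, and the maximum is attained uniquely at the point β' = (β'_1,…,β'_N) with β'_i = −p_i r_i^{s̃} / (Σ_{j=1}^N p_j r_j^{s̃} log r_j) for i = 1,…,N. -/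
open Set

noncomputable section

theorem mul_log_sub_log_le {a x : ℝ} (ha : 0 < a) (hx : 0 ≤ x) :
    x * (Real.log a - Real.log x) ≤ a - x := by
  rcases hx.eq_or_lt with rfl | hx
  · simpa using ha.le
  · rw [← Real.log_div ha.ne' hx.ne']
    calc x * Real.log (a / x) ≤ x * (a / x - 1) :=
          mul_le_mul_of_nonneg_left (Real.log_le_sub_one_of_pos (div_pos ha hx)) hx.le
      _ = a - x := by field_simp

theorem eq_of_mul_log_sub_log_eq {a x : ℝ} (ha : 0 < a) (hx : 0 ≤ x)
    (h : x * (Real.log a - Real.log x) = a - x) : x = a := by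
  rcases hx.eq_or_lt with rfl | hx
  · simp at h
    exact h
  · by_contra hne
    rw [← Real.log_div ha.ne' hx.ne'] at h
    have h1 : a / x ≠ 1 := fun h' => hne ((div_eq_one_iff_eq hx.ne').1 h').symm
    have h2 := mul_lt_mul_of_pos_left (Real.log_lt_sub_one_of_pos (div_pos ha hx) h1) hx
    have h3 : x * (a / x - 1) = a - x := by field_simp
    linarith

/-- The Gibbs weights `M p_i r_i ^ s`. -/
def gibbsWeight {N : ℕ} (M : ℕ) (p r : Fin N → ℝ) (s : ℝ) (i : Fin N) : ℝ :=
  M * p i * r i ^ s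

theorem gibbsWeight_pos {N M : ℕ} {p r : Fin N → ℝ} (hM : 0 < M) (hp : ∀ i, 0 < p i)
    (hr : ∀ i, 0 < r i) (s : ℝ) (i : Fin N) : 0 < gibbsWeight M p r s i :=
  mul_pos (mul_pos (Nat.cast_pos.2 hM) (hp i)) (Real.rpow_pos_of_pos (hr i) s)

theorem sum_gibbsWeight {N M : ℕ} {p r : Fin N → ℝ} {s : ℝ} (hM : 0 < M)
    (hs : ∑ i, p i * r i ^ s = 1 / M) : ∑ i, gibbsWeight M p r s i = 1 := by
  have hM' : (M : ℝ) ≠ 0 := Nat.cast_ne_zero.2 hM.ne'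
  simp only [gibbsWeight, mul_assoc, ← Finset.mul_sum]
  rw [hs]
  field_simp

theorem sum_pos_of_hFn_eq_one {N : ℕ} {r x : Fin N → ℝ} (hx : ∀ i, 0 ≤ x i)
    (h : hFn N r x = 1) : 0 < ∑ i, x i := by
  refine (Finset.sum_nonneg fun i _ => hx i).lt_of_ne' fun h0 => ?_
  have hz := (Finset.sum_eq_zero_iff_of_nonneg fun i _ => hx i).1 h0
  simp only [Finset.mem_univ, forall_true_left] at hz
  simp [hFn, hz] at h

/-- On the hyperplane `h = 1`, the functional minus `s` is a negative relative entropy. -/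
theorem psiFn_add_phiFn_sub {N M : ℕ} {p r x : Fin N → ℝ} {s : ℝ} (hM : 0 < M)
    (hp : ∀ i, 0 < p i) (hr : ∀ i, 0 < r i) (hx : ∀ i, 0 ≤ x i) (h : hFn N r x = 1) :
    psiFn N x + phiFn N M p x - s =
      ∑ i, x i * (Real.log ((∑ j, x j) * gibbsWeight M p r s i) - Real.log (x i)) := by
  have hS := sum_pos_of_hFn_eq_one hx h
  have hlog (i : Fin N) : Real.log ((∑ j, x j) * gibbsWeight M p r s i) =
      Real.log (∑ j, x j) + Real.log (M * p i) + s * Real.log (r i) := by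
    have hMp : (0 : ℝ) < M * p i := mul_pos (Nat.cast_pos.2 hM) (hp i)
    rw [Real.log_mul hS.ne' (gibbsWeight_pos hM hp hr s i).ne', gibbsWeight,
      Real.log_mul hMp.ne' (Real.rpow_pos_of_pos (hr i) s).ne', Real.log_rpow (hr i)]
    ring
  calc psiFn N x + phiFn N M p x - s
      = psiFn N x + phiFn N M p x - s * hFn N r x := by rw [h, mul_one]
    _ = _ := by
      simp only [hlog, psiFn, phiFn, hFn, mul_neg, sub_neg_eq_add, Finset.mul_sum,
        ← Finset.sum_add_distrib]
      exact Finset.sum_congr rfl fun i _ => by ring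

theorem max_psi_add_phi_on_hyperplane
    {N : ℕ} (hN : 2 ≤ N) (r : Fin N → ℝ) (hr : ∀ i, r i ∈ Ioo (0 : ℝ) 1)
    (M : ℕ) (hM : 2 ≤ M)
    (p : Fin N → ℝ) (hp : ∀ i, p i ∈ Ioo (0 : ℝ) 1) (hpsum : ∑ i, p i = 1)
    (st : ℝ) (hst : ∑ i, p i * r i ^ st = 1 / M) :
    ∃ β : Fin N → ℝ,
      (∀ i, β i = -(p i * r i ^ st) / ∑ j, p j * r j ^ st * Real.log (r j)) ∧
      (∀ i, 0 ≤ β i) ∧ hFn N r β = 1 ∧ psiFn N β + phiFn N M p β = st ∧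
      (∀ x : Fin N → ℝ, (∀ i, 0 ≤ x i) → hFn N r x = 1 → psiFn N x + phiFn N M p x ≤ st) ∧
      (∀ x : Fin N → ℝ, (∀ i, 0 ≤ x i) → hFn N r x = 1 →
        psiFn N x + phiFn N M p x = st → x = β) := by
  have hM0 : 0 < M := by omega
  have hMR : (M : ℝ) ≠ 0 := Nat.cast_ne_zero.2 hM0.ne'
  have hp0 (i : Fin N) : 0 < p i := (hp i).1
  have hr0 (i : Fin N) : 0 < r i := (hr i).1
  have hq := gibbsWeight_pos hM0 hp0 hr0 st
  have hq1 := sum_gibbsWeight hM0 hst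
  have hgap (x : Fin N → ℝ) :
      ∑ i, ((∑ j, x j) * gibbsWeight M p r st i - x i) = 0 := by
    rw [Finset.sum_sub_distrib, ← Finset.mul_sum, hq1, mul_one, sub_self]
  set D := ∑ j, p j * r j ^ st * Real.log (r j) with hD
  have hDneg : D < 0 := by
    refine Finset.sum_neg (fun j _ => ?_) ⟨⟨0, by omega⟩, Finset.mem_univ _⟩
    exact mul_neg_of_pos_of_neg (mul_pos (hp0 j) (Real.rpow_pos_of_pos (hr0 j) st))
      (Real.log_neg (hr0 j) (hr j).2)
  have hscale (S : ℝ) : hFn N r (fun i => S * gibbsWeight M p r st i) = -(S * M * D) := by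
    simp only [hFn, hD, gibbsWeight, Finset.mul_sum]
    exact congrArg Neg.neg (Finset.sum_congr rfl fun i _ => by ring)
  have hβ (i : Fin N) :
      -(p i * r i ^ st) / D = -1 / (M * D) * gibbsWeight M p r st i := by
    have := hDneg.ne
    rw [gibbsWeight]
    field_simp
  have hβ0 (i : Fin N) : 0 ≤ -(p i * r i ^ st) / D :=
    div_nonneg_of_nonpos
      (neg_nonpos.2 (mul_pos (hp0 i) (Real.rpow_pos_of_pos (hr0 i) st)).le) hDneg.le
  have hβ1 : hFn N r (fun i => -(p i * r i ^ st) / D) = 1 := by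
    have := hDneg.ne
    simp only [hβ, hscale]
    field_simp
  refine ⟨fun i => -(p i * r i ^ st) / D, fun _ => rfl, hβ0, hβ1, ?_, ?_, ?_⟩
  · rw [← sub_eq_zero, psiFn_add_phiFn_sub hM0 hp0 hr0 hβ0 hβ1]
    refine Finset.sum_eq_zero fun i _ => ?_
    simp only [hβ, ← Finset.mul_sum, hq1, mul_one, sub_self, mul_zero]
  · intro x hx h
    rw [← sub_nonpos, psiFn_add_phiFn_sub hM0 hp0 hr0 hx h, ← hgap x]
    exact Finset.sum_le_sum fun i _ =>
      mul_log_sub_log_le (mul_pos (sum_pos_of_hFn_eq_one hx h) (hq i)) (hx i)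
  · intro x hx h hmax
    have hS := sum_pos_of_hFn_eq_one hx h
    rw [← sub_eq_zero, psiFn_add_phiFn_sub hM0 hp0 hr0 hx h, ← hgap x,
      Finset.sum_eq_sum_iff_of_le fun i _ =>
        mul_log_sub_log_le (mul_pos hS (hq i)) (hx i)] at hmax
    have hxS (i : Fin N) : x i = (∑ j, x j) * gibbsWeight M p r st i :=
      eq_of_mul_log_sub_log_eq (mul_pos hS (hq i)) (hx i) (hmax i (Finset.mem_univ i))
    have hSD := hscale (∑ j, x j)
    rw [← funext hxS, h] at hSD
    have hSval : ∑ j, x j = -1 / (M * D) := by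
      rw [eq_div_iff (mul_ne_zero hMR hDneg.ne)]
      linarith
    funext i
    rw [hβ, ← hSval]
    exact hxS i
end
end

section
/- Let N ≥ 2, r_1,…,r_N ∈ (0,1), M ≥ 2 an integer, p = (p_1,…,p_N) ∈ (0,1)^N a probability vector, s_0 the unique real with Σ r_i^{s_0} = 1 and s̃ the unique real with Σ p_i r_i^{s̃} = 1/M. Assume Σ_{i=1}^N r_i^{s_0} log(M p_i) < 0 < Σ_{i=1}^N p_i r_i^{s̃} log(M p_i), and let (ŝ, t̂) be the unique pair with ŝ > 0 satisfying Σ_{i=1}^N r_i^{ŝ}(M p_i)^{t̂} = 1 and Σ_{i=1}^N r_i^{ŝ}(M p_i)^{t̂} log(M p_i) = 0. Then max{ ψ(x) : x ∈ [0,∞)^N, h(x) = 1, φ(x) = 0 } = ŝ, attained uniquely at the point β̂ = (β̂_1,…,β̂_N) with β̂_i = −r_i^{ŝ}(M p_i)^{t̂} / (Σ_{j=1}^N r_j^{ŝ}(M p_j)^{t̂} log r_j); moreover, max{ ψ(x) + min{0, φ(x)} : x ∈ [0,∞)^N, h(x) = 1 } = ŝ. -/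
open Set

noncomputable section

/-- A single term of Gibbs' inequality. -/
lemma mul_log_sub_log_le_s17 {S x q : ℝ} (hS : 0 ≤ S) (hx : 0 ≤ x) (hxS : x ≤ S) (hq : 0 < q) :
    x * (Real.log S - Real.log x + Real.log q) ≤ S * q - x ∧
      (x * (Real.log S - Real.log x + Real.log q) = S * q - x → x = S * q) := by
  rcases hx.eq_or_lt with rfl | hx0
  · simp only [zero_mul, sub_zero]
    exact ⟨by positivity, id⟩
  have hS0 : 0 < S := hx0.trans_le hxS
  have hu : 0 < S * q / x := by positivity
  have hlog : Real.log S - Real.log x + Real.log q = Real.log (S * q / x) := by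
    rw [Real.log_div (by positivity) hx0.ne', Real.log_mul hS0.ne' hq.ne']
    ring
  have hmul : S * q - x = x * (S * q / x - 1) := by field_simp
  rw [hlog, hmul]
  refine ⟨mul_le_mul_of_nonneg_left (Real.log_le_sub_one_of_pos hu) hx, fun h => ?_⟩
  by_contra hne
  have hu1 : S * q / x ≠ 1 := fun h1 => hne ((div_eq_one_iff_eq hx0.ne').1 h1).symm
  exact (mul_lt_mul_of_pos_left (Real.log_lt_sub_one_of_pos hu hu1) hx0).ne h

/-- Gibbs' inequality for `psiFn`, with its equality case. -/
lemma psiFn_le_neg_sum_mul_log {N : ℕ} {x q : Fin N → ℝ} (hx : ∀ i, 0 ≤ x i)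
    (hq : ∀ i, 0 < q i) (hqsum : ∑ i, q i = 1) :
    psiFn N x ≤ -∑ i, x i * Real.log (q i) ∧
      (psiFn N x = -∑ i, x i * Real.log (q i) → ∀ i, x i = (∑ j, x j) * q i) := by
  have hterm := fun i => mul_log_sub_log_le_s17 (Finset.sum_nonneg fun j _ => hx j) (hx i)
    (Finset.single_le_sum (fun j _ => hx j) (Finset.mem_univ i)) (hq i)
  have hleft : ∑ i, x i * (Real.log (∑ j, x j) - Real.log (x i) + Real.log (q i)) =
      psiFn N x + ∑ i, x i * Real.log (q i) := by
    simp only [psiFn, mul_add, Finset.sum_add_distrib]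
  have hright : ∑ i, ((∑ j, x j) * q i - x i) = 0 := by
    rw [Finset.sum_sub_distrib, ← Finset.mul_sum, hqsum, mul_one, sub_self]
  have hsum := Finset.sum_le_sum fun i (_ : i ∈ Finset.univ) => (hterm i).1
  refine ⟨by linarith, fun h i => (hterm i).2 ?_⟩
  exact (Finset.sum_eq_sum_iff_of_le fun i _ => (hterm i).1).1 (by linarith) i (Finset.mem_univ i)

lemma psiFn_const_mul {N : ℕ} {c : ℝ} {q : Fin N → ℝ} (hc : 0 < c)
    (hq : ∀ i, 0 < q i) (hqsum : ∑ i, q i = 1) :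
    psiFn N (fun i => c * q i) = -∑ i, c * q i * Real.log (q i) := by
  rw [psiFn, ← Finset.mul_sum, hqsum, mul_one, ← Finset.sum_neg_distrib]
  refine Finset.sum_congr rfl fun i _ => ?_
  rw [Real.log_mul hc.ne' (hq i).ne']
  ring

lemma neg_sum_mul_log_weight {N M : ℕ} {r p : Fin N → ℝ} (hr : ∀ i, 0 < r i)
    (hMp : ∀ i, 0 < M * p i) {s t : ℝ} {q : Fin N → ℝ} (hq : ∀ i, q i = r i ^ s * (M * p i) ^ t)
    (x : Fin N → ℝ) :
    -∑ i, x i * Real.log (q i) = s * hFn N r x - t * phiFn N M p x := by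
  simp only [hFn, phiFn, mul_neg, Finset.mul_sum, ← Finset.sum_neg_distrib,
    ← Finset.sum_sub_distrib]
  refine Finset.sum_congr rfl fun i _ => ?_
  rw [hq, Real.log_mul (Real.rpow_pos_of_pos (hr i) s).ne' (Real.rpow_pos_of_pos (hMp i) t).ne',
    Real.log_rpow (hr i), Real.log_rpow (hMp i)]
  ring

lemma hFn_pos {N : ℕ} {r x : Fin N → ℝ} (hr : ∀ i, r i ∈ Ioo (0 : ℝ) 1)
    (hx : ∀ i, 0 < x i) (hxsum : ∑ i, x i = 1) : 0 < hFn N r x := by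
  have hne : (Finset.univ : Finset (Fin N)).Nonempty := by
    by_contra h
    simp [Finset.not_nonempty_iff_eq_empty.1 h] at hxsum
  exact neg_pos.2 (Finset.sum_neg (fun i _ =>
    mul_neg_of_pos_of_neg (hx i) (Real.log_neg (hr i).1 (hr i).2)) hne)

/-- Comparing the weights `r ^ s * (M p) ^ t` and `r ^ s' * (M p) ^ t'` by Gibbs' inequality in
both directions, when the first one has `φ = 0`. -/
lemma sub_mul_phiFn_weight_nonpos {N M : ℕ} {r p : Fin N → ℝ} (hr : ∀ i, r i ∈ Ioo (0 : ℝ) 1)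
    (hMp : ∀ i, 0 < M * p i) {s t s' t' : ℝ} {q a : Fin N → ℝ}
    (hq : ∀ i, q i = r i ^ s * (M * p i) ^ t) (ha : ∀ i, a i = r i ^ s' * (M * p i) ^ t')
    (hqsum : ∑ i, q i = 1) (hasum : ∑ i, a i = 1) (hφ : phiFn N M p q = 0) :
    (t - t') * phiFn N M p a ≤ 0 := by
  have hr0 := fun i => (hr i).1
  have hqpos : ∀ i, 0 < q i := fun i => hq i ▸
    mul_pos (Real.rpow_pos_of_pos (hr0 i) s) (Real.rpow_pos_of_pos (hMp i) t)
  have hapos : ∀ i, 0 < a i := fun i => ha i ▸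
    mul_pos (Real.rpow_pos_of_pos (hr0 i) s') (Real.rpow_pos_of_pos (hMp i) t')
  have hψq := psiFn_const_mul one_pos hqpos hqsum
  have hψa := psiFn_const_mul one_pos hapos hasum
  have hqa := (psiFn_le_neg_sum_mul_log (fun i => (hqpos i).le) hapos hasum).1
  have haq := (psiFn_le_neg_sum_mul_log (fun i => (hapos i).le) hqpos hqsum).1
  simp only [one_mul] at hψq hψa
  rw [hψq, neg_sum_mul_log_weight hr0 hMp hq, neg_sum_mul_log_weight hr0 hMp ha, hφ] at hqa
  rw [hψa, neg_sum_mul_log_weight hr0 hMp hq, neg_sum_mul_log_weight hr0 hMp ha] at haq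
  have hss : s ≤ s' := le_of_mul_le_mul_right (by linarith) (hFn_pos hr hqpos hqsum)
  nlinarith [mul_le_mul_of_nonneg_right hss (hFn_pos hr hapos hasum).le]

theorem max_psi_on_phi_zero_hyperplane
    {N : ℕ} (hN : 2 ≤ N) (r : Fin N → ℝ) (hr : ∀ i, r i ∈ Ioo (0 : ℝ) 1)
    (M : ℕ) (hM : 2 ≤ M)
    (p : Fin N → ℝ) (hp : ∀ i, p i ∈ Ioo (0 : ℝ) 1) (hpsum : ∑ i, p i = 1)
    (s₀ : ℝ) (hs₀ : ∑ i, r i ^ s₀ = 1)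
    (st : ℝ) (hst : ∑ i, p i * r i ^ st = 1 / M)
    (hcond₁ : ∑ i, r i ^ s₀ * Real.log (M * p i) < 0)
    (hcond₂ : 0 < ∑ i, p i * r i ^ st * Real.log (M * p i))
    (sh th : ℝ) (hsh : 0 < sh)
    (heq₁ : ∑ i, r i ^ sh * (M * p i) ^ th = 1)
    (heq₂ : ∑ i, r i ^ sh * (M * p i) ^ th * Real.log (M * p i) = 0) :
    ∃ β : Fin N → ℝ,
      (∀ i, β i = -(r i ^ sh * (M * p i) ^ th) /
        ∑ j, r j ^ sh * (M * p j) ^ th * Real.log (r j)) ∧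
      (∀ i, 0 ≤ β i) ∧ hFn N r β = 1 ∧ phiFn N M p β = 0 ∧ psiFn N β = sh ∧
      (∀ x : Fin N → ℝ, (∀ i, 0 ≤ x i) → hFn N r x = 1 → phiFn N M p x = 0 →
        psiFn N x ≤ sh) ∧
      (∀ x : Fin N → ℝ, (∀ i, 0 ≤ x i) → hFn N r x = 1 → phiFn N M p x = 0 →
        psiFn N x = sh → x = β) ∧
      IsGreatest {y : ℝ | ∃ x : Fin N → ℝ, (∀ i, 0 ≤ x i) ∧ hFn N r x = 1 ∧
        y = psiFn N x + min 0 (phiFn N M p x)} sh := by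
  have hr0 := fun i => (hr i).1
  have hM0 : (0 : ℝ) < M := by exact_mod_cast (by omega : 0 < M)
  have hMp : ∀ i, 0 < M * p i := fun i => mul_pos hM0 (hp i).1
  obtain ⟨q, hq⟩ : ∃ q : Fin N → ℝ, ∀ i, q i = r i ^ sh * (M * p i) ^ th := ⟨_, fun _ => rfl⟩
  have hqpos : ∀ i, 0 < q i := fun i => hq i ▸
    mul_pos (Real.rpow_pos_of_pos (hr0 i) sh) (Real.rpow_pos_of_pos (hMp i) th)
  simp only [← hq] at heq₁ heq₂ ⊢
  have hlogq := neg_sum_mul_log_weight hr0 hMp hq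
  have hth0 : 0 ≤ th := by
    have h := sub_mul_phiFn_weight_nonpos (s' := s₀) (t' := 0) (a := fun i => r i ^ s₀)
      hr hMp hq (fun i => by simp) heq₁ hs₀ heq₂
    by_contra! hneg
    have : phiFn N M p (fun i => r i ^ s₀) < 0 := hcond₁
    nlinarith
  have hth1 : th ≤ 1 := by
    have hasum : ∑ i, r i ^ st * (M * p i) = 1 := by
      calc ∑ i, r i ^ st * (M * p i) = M * ∑ i, p i * r i ^ st := by
            rw [Finset.mul_sum]
            exact Finset.sum_congr rfl fun i _ => by ring
        _ = 1 := by rw [hst, mul_one_div_cancel hM0.ne']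
    have h := sub_mul_phiFn_weight_nonpos (s' := st) (t' := 1)
      (a := fun i => r i ^ st * (M * p i)) hr hMp hq (fun i => by simp) heq₁ hasum heq₂
    have hφ : 0 < phiFn N M p (fun i => r i ^ st * (M * p i)) := by
      calc 0 < M * ∑ i, p i * r i ^ st * Real.log (M * p i) := mul_pos hM0 hcond₂
        _ = _ := by
            rw [phiFn, Finset.mul_sum]
            exact Finset.sum_congr rfl fun i _ => by ring
    by_contra! hgt
    nlinarith
  have hDpos : 0 < hFn N r q := hFn_pos hr hqpos heq₁
  set D := ∑ j, q j * Real.log (r j) with hD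
  have hD0 : 0 < -D := hDpos
  obtain ⟨c, hc⟩ : ∃ c, c = (-D)⁻¹ := ⟨_, rfl⟩
  have hcpos : 0 < c := hc ▸ inv_pos.2 hD0
  have hβ : (fun i => -q i / D) = fun i => c * q i := by
    funext i
    rw [hc, inv_neg]
    ring
  have hhmul : ∀ b : ℝ, hFn N r (fun i => b * q i) = b * -D := by
    intro b
    simp only [hFn, hD, mul_assoc, ← Finset.mul_sum, mul_neg]
  have hh : hFn N r (fun i => c * q i) = 1 := by
    rw [hhmul, hc, inv_mul_cancel₀ hD0.ne']
  have hφ : phiFn N M p (fun i => c * q i) = 0 := by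
    simp only [phiFn, mul_assoc, ← Finset.mul_sum, heq₂, mul_zero]
  have hψ : psiFn N (fun i => c * q i) = sh := by
    rw [psiFn_const_mul hcpos hqpos heq₁, hlogq (fun i => c * q i), hh, hφ]
    ring
  have hβ0 : ∀ i, 0 ≤ c * q i := fun i => (mul_pos hcpos (hqpos i)).le
  have hle : ∀ x : Fin N → ℝ, (∀ i, 0 ≤ x i) → hFn N r x = 1 →
      psiFn N x ≤ sh - th * phiFn N M p x := by
    intro x hx hx1
    have h := (psiFn_le_neg_sum_mul_log hx hqpos heq₁).1
    rwa [hlogq, hx1, mul_one] at h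
  refine ⟨fun i => c * q i, fun i => (congrFun hβ i).symm, hβ0, hh, hφ, hψ, ?_, ?_,
    ⟨fun i => c * q i, hβ0, hh, by simp [hψ, hφ]⟩, ?_⟩
  · intro x hx hx1 hx0
    simpa [hx0] using hle x hx hx1
  · intro x hx hx1 hx0 hxψ
    have hxq := (psiFn_le_neg_sum_mul_log hx hqpos heq₁).2 (by rw [hlogq, hx1, hx0, hxψ]; ring)
    have hS : (∑ j, x j) * -D = 1 := by rw [← hhmul, ← funext hxq, hx1]
    funext i
    rw [hxq i, hc, eq_inv_of_mul_eq_one_left hS]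
  · rintro y ⟨x, hx, hx1, rfl⟩
    have h := hle x hx hx1
    rcases le_total 0 (phiFn N M p x) with h0 | h0
    · rw [min_eq_left h0]
      nlinarith
    · rw [min_eq_right h0]
      nlinarith
end
end
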